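/- Let i, k be integers with 2 ≤ k and i ≤ k. If G is a graph with |G| ≥ 16k + 3i and |H_k(G)| − |L_k(G)| ≥ 3k − i, then G contains k vertex-disjoint cycles. -/

import Mathlib

/-- `G` contains `k` pairwise vertex-disjoint cycles. -/
def HasDisjointCycles {V : Type*} (G : SimpleGraph V) (k : ℕ) : Prop :=
  ∃ c : Fin k → (v : V) × G.Walk v v,
    (∀ i, (c i).2.IsCycle) ∧
    ∀ i j, i ≠ j → List.Disjoint (c i).2.support (c j).2.support

/-- `H_k(G)`: the set of vertices of degree at least `2k`. -/
def highSet {V : Type*} [Fintype V] (G : SimpleGraph V) [DecidableRel G.Adj] (k : ℕ) :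
    Finset V :=
  Finset.univ.filter fun v => 2 * k ≤ G.degree v

/-- `L_k(G)`: the set of vertices of degree at most `2k - 2`. -/
def lowSet {V : Type*} [Fintype V] (G : SimpleGraph V) [DecidableRel G.Adj] (k : ℕ) :
    Finset V :=
  Finset.univ.filter fun v => G.degree v ≤ 2 * k - 2

namespace DisjointCycles
open Finset
open scoped Classical

noncomputable section

variable {V : Type*} {G : SimpleGraph V}

/-- Indicator of adjacency. -/
def ad (G : SimpleGraph V) (u v : V) : ℕ := if G.Adj u v then 1 else 0

/-- Number of neighbours of `v` inside `S`. -/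
def dg (G : SimpleGraph V) (S : Finset V) (v : V) : ℕ := ∑ u ∈ S, ad G v u

/-- Number of edges of `G` inside `S`. -/
def ed (G : SimpleGraph V) (S : Finset V) : ℕ := (∑ v ∈ S, dg G S v) / 2

/-- A nonempty vertex set spanning at least as many edges as it has vertices. -/
def Dense (G : SimpleGraph V) (K : Finset V) : Prop := K.Nonempty ∧ #K ≤ ed G K

/-- `S` contains `k` pairwise disjoint dense sets. -/
def Pack (G : SimpleGraph V) : Finset V → ℕ → Prop
  | _, 0 => True
  | S, k + 1 => ∃ K ⊆ S, Dense G K ∧ Pack G (S \ K) k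

lemma ad_comm (u v : V) : ad G u v = ad G v u := by simp [ad, G.adj_comm]

@[simp] lemma ad_self (u : V) : ad G u u = 0 := by simp [ad]

lemma ad_le_one (u v : V) : ad G u v ≤ 1 := by unfold ad; split_ifs <;> simp

lemma ad_of_adj {u v : V} (h : G.Adj u v) : ad G u v = 1 := by simp [ad, h]

lemma ad_of_not_adj {u v : V} (h : ¬ G.Adj u v) : ad G u v = 0 := by simp [ad, h]

lemma dg_eq_card (S : Finset V) (v : V) : dg G S v = #(S.filter (G.Adj v)) := by
  rw [dg, card_filter]; rfl

@[simp] lemma dg_empty (v : V) : dg G ∅ v = 0 := by simp [dg]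

@[simp] lemma dg_singleton (x v : V) : dg G {x} v = ad G v x := by simp [dg]

lemma dg_insert {S : Finset V} {x : V} (h : x ∉ S) (v : V) :
    dg G (insert x S) v = ad G v x + dg G S v := by simp [dg, sum_insert h]

lemma dg_erase {S : Finset V} {x : V} (h : x ∈ S) (v : V) :
    ad G v x + dg G (S.erase x) v = dg G S v := by
  rw [← dg_insert (notMem_erase x S), insert_erase h]

lemma dg_union {A B : Finset V} (h : Disjoint A B) (v : V) :
    dg G (A ∪ B) v = dg G A v + dg G B v := by simp [dg, sum_union h]

lemma dg_sdiff {S T : Finset V} (h : T ⊆ S) (v : V) :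
    dg G (S \ T) v + dg G T v = dg G S v := by simp [dg, sum_sdiff h]

lemma dg_mono {S T : Finset V} (h : S ⊆ T) (v : V) : dg G S v ≤ dg G T v :=
  sum_le_sum_of_subset h

lemma dg_le_card (S : Finset V) (v : V) : dg G S v ≤ #S := by
  rw [dg_eq_card]; exact card_filter_le _ _

lemma dg_lt_card {S : Finset V} {v : V} (h : v ∈ S) : dg G S v + 1 ≤ #S := by
  have h1 := dg_erase (G := G) h v
  have h2 := dg_le_card (G := G) (S.erase v) v
  rw [card_erase_of_mem h] at h2
  have := card_pos.2 ⟨v, h⟩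
  rw [ad_self] at h1
  omega

lemma exists_adj_of_dg_pos {S : Finset V} {v : V} (h : 0 < dg G S v) : ∃ u ∈ S, G.Adj v u := by
  rw [dg_eq_card] at h
  obtain ⟨u, hu⟩ := card_pos.1 h
  exact ⟨u, (mem_filter.1 hu).1, (mem_filter.1 hu).2⟩

lemma ad_le_dg {S : Finset V} {u : V} (h : u ∈ S) (v : V) : ad G v u ≤ dg G S v := by
  have := dg_erase (G := G) h v
  omega

lemma sum_dg_comm (A B : Finset V) : ∑ a ∈ A, dg G B a = ∑ b ∈ B, dg G A b := by
  simp only [dg]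
  rw [sum_comm]
  exact sum_congr rfl fun b _ => sum_congr rfl fun a _ => ad_comm _ _

lemma sum_dg_insert {S : Finset V} {x : V} (h : x ∉ S) :
    ∑ v ∈ insert x S, dg G (insert x S) v = 2 * dg G S x + ∑ v ∈ S, dg G S v := by
  rw [sum_insert h, dg_insert h, ad_self]
  simp only [dg_insert h, sum_add_distrib]
  have : ∑ v ∈ S, ad G v x = dg G S x := by
    simp only [dg]; exact sum_congr rfl fun b _ => ad_comm _ _
  omega

lemma two_mul_ed (S : Finset V) : 2 * ed G S = ∑ v ∈ S, dg G S v := by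
  have : Even (∑ v ∈ S, dg G S v) := by
    induction S using Finset.induction_on with
    | empty => simp
    | insert x S hx ih => rw [sum_dg_insert hx]; exact (even_two_mul _).add ih
  unfold ed
  obtain ⟨m, hm⟩ := this
  omega

lemma ed_insert {S : Finset V} {x : V} (h : x ∉ S) : ed G (insert x S) = dg G S x + ed G S := by
  have h1 := two_mul_ed (G := G) (insert x S)
  have h2 := two_mul_ed (G := G) S
  rw [sum_dg_insert h] at h1
  omega

lemma dg_erase_self (S : Finset V) (x : V) : dg G (S.erase x) x = dg G S x := by
  by_cases h : x ∈ S
  · have := dg_erase (G := G) h x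
    simpa using this
  · rw [erase_eq_of_notMem h]

lemma ed_erase {S : Finset V} {x : V} (h : x ∈ S) : dg G S x + ed G (S.erase x) = ed G S := by
  have := ed_insert (G := G) (notMem_erase x S)
  rw [insert_erase h, dg_erase_self] at this
  omega

@[simp] lemma ed_empty : ed G ∅ = 0 := by simp [ed]

@[simp] lemma ed_singleton (x : V) : ed G {x} = 0 := by simp [ed]

lemma three_le_card {D : Finset V} (h : Dense G D) : 3 ≤ #D := by
  obtain ⟨h0, h1⟩ := h
  have h2 := two_mul_ed (G := G) D
  have h3 : ∑ v ∈ D, dg G D v ≤ ∑ v ∈ D, (#D - 1) :=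
    sum_le_sum fun v hv => by have := dg_lt_card (G := G) hv; omega
  rw [sum_const, smul_eq_mul] at h3
  have h4 := card_pos.2 h0
  by_contra h5
  have h6 : #D = 1 ∨ #D = 2 := by omega
  rcases h6 with h6 | h6 <;> rw [h6] at h3 <;> omega

lemma ed_lt_of_not_dense {Y : Finset V} (h : ¬ Dense G Y) (h0 : Y.Nonempty) :
    ed G Y + 1 ≤ #Y := by
  by_contra h1
  exact h ⟨h0, by omega⟩

lemma exists_leaf {Y : Finset V} (h : ¬ Dense G Y) (h0 : Y.Nonempty) : ∃ v ∈ Y, dg G Y v ≤ 1 := by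
  by_contra! h1
  have h2 := two_mul_ed (G := G) Y
  have h3 : ∑ v ∈ Y, 2 ≤ ∑ v ∈ Y, dg G Y v := sum_le_sum fun v hv => h1 v hv
  rw [sum_const, smul_eq_mul] at h3
  exact h ⟨h0, by omega⟩

lemma dg_eq_two_of_min {D : Finset V} (h : Dense G D) (hm : ∀ x ∈ D, ¬ Dense G (D.erase x)) :
    ed G D = #D ∧ ∀ x ∈ D, dg G D x = 2 := by
  have h3 := three_le_card h
  have key : ∀ x ∈ D, ed G D + 2 ≤ #D + dg G D x := by
    intro x hx
    have h1 := ed_erase (G := G) hx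
    have h2 : #(D.erase x) = #D - 1 := card_erase_of_mem hx
    have := ed_lt_of_not_dense (hm x hx) (card_pos.1 (by omega))
    omega
  have h4 := two_mul_ed (G := G) D
  have h5 : ∑ x ∈ D, (ed G D + 2) ≤ ∑ x ∈ D, (#D + dg G D x) := sum_le_sum key
  simp only [sum_add_distrib, sum_const, smul_eq_mul, ← h4] at h5
  have h6 : ed G D = #D := by
    refine le_antisymm ?_ h.2
    have := h.2
    nlinarith
  refine ⟨h6, ?_⟩
  have h7 : ∀ x ∈ D, 2 ≤ dg G D x := fun x hx => by have := key x hx; omega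
  have h8 : ∑ x ∈ D, 2 = ∑ x ∈ D, dg G D x := by
    rw [sum_const, smul_eq_mul]; omega
  intro x hx
  exact ((sum_eq_sum_iff_of_le h7).1 h8 x hx).symm

lemma exists_min_dense {S : Finset V} {D : Finset V} (hD : D ⊆ S) (h : Dense G D) :
    ∃ E ⊆ S, Dense G E ∧ ∀ K ⊆ S, Dense G K → #E ≤ #K := by
  obtain ⟨E, hE, hm⟩ := exists_min_image (S.powerset.filter (Dense G)) card
    ⟨D, by simp [hD, h]⟩
  simp only [mem_filter, mem_powerset] at hE hm
  exact ⟨E, hE.1, hE.2, fun K h1 h2 => hm K ⟨h1, h2⟩⟩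

lemma Dense.insert {K : Finset V} {w : V} (hw : w ∉ K) (h : #K + 1 ≤ ed G K + dg G K w) :
    Dense G (insert w K) := by
  refine ⟨insert_nonempty _ _, ?_⟩
  rw [card_insert_of_notMem hw, ed_insert hw]
  omega

lemma dense_triple {x y z : V} (h1 : G.Adj x y) (h2 : G.Adj y z) (h3 : G.Adj x z) :
    Dense G {x, y, z} := by
  refine ⟨insert_nonempty _ _, ?_⟩
  have a1 := h1.ne
  have a2 := h2.ne
  have a3 := h3.ne
  rw [ed_insert (by simp [a1, a3]), ed_insert (by simp [a2]), dg_insert (by simp [a2]), dg_singleton, dg_singleton,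
    card_insert_of_notMem (by simp [a1, a3]), card_insert_of_notMem (by simp [a2])]
  simp [ad_of_adj h1, ad_of_adj h2, ad_of_adj h3]

lemma dense_quad {w x y z : V} (h1 : G.Adj w x) (h2 : G.Adj x y) (h3 : G.Adj y z)
    (h4 : G.Adj z w) (hwy : w ≠ y) (hxz : x ≠ z) : Dense G {w, x, y, z} := by
  refine ⟨insert_nonempty _ _, ?_⟩
  have a1 := h1.ne
  have a2 := h2.ne
  have a3 := h3.ne
  have a4 := h4.ne'
  rw [ed_insert (by simp [a1, a4, hwy]), ed_insert (by simp [a2, hxz]), ed_insert (by simp [a3]),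
    dg_insert (by simp [a2, hxz]), dg_insert (by simp [a3]), dg_insert (by simp [a3]),
    dg_singleton, dg_singleton, dg_singleton, ad_of_adj h1, ad_of_adj h2, ad_of_adj h3,
    ad_of_adj h4.symm,
    card_insert_of_notMem (by simp [a1, a4, hwy]), card_insert_of_notMem (by simp [a2, hxz]),
    card_insert_of_notMem (by simp [a3])]
  simp only [card_singleton, ed_singleton]
  omega

lemma one_neighbour {S D : Finset V} (hD : D ⊆ S) (h : Dense G D)
    (hmin : ∀ K ⊆ S, Dense G K → #D ≤ #K) (h5 : 5 ≤ #D) {w : V} (hw : w ∈ S) (hwD : w ∉ D) :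
    dg G D w ≤ 1 := by
  by_contra! hc
  have hm : ∀ x ∈ D, ¬ Dense G (D.erase x) := fun x hx h1 => by
    have := hmin _ ((erase_subset _ _).trans hD) h1
    rw [card_erase_of_mem hx] at this
    omega
  obtain ⟨he, h2⟩ := dg_eq_two_of_min h hm
  rw [dg_eq_card] at hc
  obtain ⟨x, hx, y, hy, hxy⟩ := one_lt_card.1 hc
  rw [mem_filter] at hx hy
  -- an edge avoiding both neighbours
  have hyx : y ∈ D.erase x := mem_erase.2 ⟨hxy.symm, hy.1⟩
  have e1 := ed_erase (G := G) hx.1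
  have e2 := ed_erase (G := G) hyx
  have e3 := dg_erase (G := G) hx.1 y
  have e4 := h2 x hx.1
  have e5 := h2 y hy.1
  have e6 : 0 < ed G ((D.erase x).erase y) := by omega
  have e7 := two_mul_ed (G := G) ((D.erase x).erase y)
  obtain ⟨p, hp, hp2⟩ : ∃ p ∈ (D.erase x).erase y, 0 < dg G ((D.erase x).erase y) p := by
    by_contra! hcon
    have : ∑ v ∈ (D.erase x).erase y, dg G ((D.erase x).erase y) v = 0 :=
      sum_eq_zero fun v hv => by have := hcon v hv; omega
    omega
  obtain ⟨q, hq, hpq⟩ := exists_adj_of_dg_pos hp2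
  simp only [mem_erase] at hp hq
  have hqp : q ∈ D.erase p := mem_erase.2 ⟨hpq.ne', hq.2.2⟩
  have f1 := ed_erase (G := G) hp.2.2
  have f2 := ed_erase (G := G) hqp
  have f3 := dg_erase (G := G) hp.2.2 q
  have f4 := h2 p hp.2.2
  have f5 := h2 q hq.2.2
  have f6 : ad G q p = 1 := ad_of_adj hpq.symm
  have hwK : w ∉ (D.erase p).erase q := fun h => hwD (mem_of_mem_erase (mem_of_mem_erase h))
  have g1 : 2 ≤ dg G ((D.erase p).erase q) w := by
    have hx' : x ∈ (D.erase p).erase q := by simp [hx.1, hp.2.1.symm, hq.2.1.symm]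
    have hy' : y ∈ ((D.erase p).erase q).erase x := by
      simp [hy.1, hp.1.symm, hq.1.symm, hxy.symm]
    have := dg_erase (G := G) hx' w
    have := ad_le_dg (G := G) hy' w
    rw [ad_of_adj hy.2] at this
    rw [ad_of_adj hx.2] at *
    omega
  have c1 : #((D.erase p).erase q) = #D - 2 := by
    rw [card_erase_of_mem hqp, card_erase_of_mem hp.2.2]; omega
  have hd : Dense G (insert w ((D.erase p).erase q)) := Dense.insert hwK (by omega)
  have := hmin _ (insert_subset hw (((erase_subset _ _).trans (erase_subset _ _)).trans hD)) hd
  rw [card_insert_of_notMem hwK] at this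
  omega

lemma Pack.mono {k : ℕ} : ∀ {S T : Finset V}, S ⊆ T → Pack G S k → Pack G T k := by
  induction k with
  | zero => intros; trivial
  | succ k ih =>
    rintro S T h ⟨K, hK, hd, hp⟩
    exact ⟨K, hK.trans h, hd, ih (sdiff_subset_sdiff h Subset.rfl) hp⟩

lemma Pack.cons {S K : Finset V} {k : ℕ} (hK : K ⊆ S) (hd : Dense G K)
    (h : Pack G (S \ K) k) : Pack G S (k + 1) := ⟨K, hK, hd, h⟩

lemma Pack.two {S K L : Finset V} (hK : K ⊆ S) (hL : L ⊆ S) (hKd : Dense G K) (hLd : Dense G L)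
    (h : Disjoint K L) : Pack G S 2 :=
  Pack.cons hK hKd ⟨L, subset_sdiff.2 ⟨hL, h.symm⟩, hLd, trivial⟩

lemma Pack.exists_family {k : ℕ} : ∀ {S : Finset V}, Pack G S k → ∃ F : Finset (Finset V),
    #F = k ∧ (∀ C ∈ F, C ⊆ S ∧ Dense G C ∧ ∀ K ⊆ C, Dense G K → #C ≤ #K) ∧
      (F : Set (Finset V)).PairwiseDisjoint id := by
  induction k with
  | zero => exact fun _ => ⟨∅, by simp⟩
  | succ k ih =>
    rintro S ⟨K, hK, hd, hp⟩
    obtain ⟨E, hE, hEd, hmin⟩ := exists_min_dense Subset.rfl hd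
    obtain ⟨F, h1, h2, h3⟩ := ih (hp.mono (sdiff_subset_sdiff Subset.rfl hE))
    have hKF : E ∉ F := fun h => by
      obtain ⟨x, hx⟩ := hEd.1
      exact (mem_sdiff.1 ((h2 E h).1 hx)).2 hx
    refine ⟨insert E F, by rw [card_insert_of_notMem hKF, h1], ?_, ?_⟩
    · intro C hC
      rcases mem_insert.1 hC with rfl | hC
      · exact ⟨hE.trans hK, hEd, fun K hK => hmin K (hK.trans hE)⟩
      · exact ⟨(h2 C hC).1.trans sdiff_subset, (h2 C hC).2⟩
    · rw [coe_insert]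
      refine h3.insert fun C hC _ => ?_
      exact (subset_sdiff.1 (h2 C hC).1).2.symm

lemma not_dense_erase {C : Finset V} (h : ∀ K ⊆ C, Dense G K → #C ≤ #K) {x : V} (hx : x ∈ C) :
    ¬ Dense G (C.erase x) := fun hd => by
  have := h _ (erase_subset _ _) hd
  rw [card_erase_of_mem hx] at this
  have := card_pos.2 ⟨x, hx⟩
  omega

lemma Pack.of_family {S : Finset V} {F : Finset (Finset V)} {j : ℕ}
    (h2 : ∀ C ∈ F, C ⊆ S ∧ Dense G C) (h3 : (F : Set (Finset V)).PairwiseDisjoint id)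
    (hp : Pack G (S \ F.biUnion id) j) : Pack G S (#F + j) := by
  induction F using Finset.induction_on generalizing S with
  | empty => simpa using hp
  | insert C F hC ih =>
    rw [card_insert_of_notMem hC, add_right_comm]
    refine Pack.cons (h2 C (mem_insert_self _ _)).1 (h2 C (mem_insert_self _ _)).2 (ih ?_ ?_ ?_)
    · intro K hK
      refine ⟨subset_sdiff.2 ⟨(h2 K (mem_insert_of_mem hK)).1, ?_⟩,
        (h2 K (mem_insert_of_mem hK)).2⟩
      exact h3 (by simp [hK]) (by simp) (by rintro rfl; exact hC hK)
    · exact h3.subset (by simp)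
    · refine hp.mono ?_
      rw [biUnion_insert, id, sdiff_sdiff_left, sup_eq_union]

lemma pack_of_min_degree (s : ℕ) : ∀ S : Finset V, S.Nonempty →
    (∀ K ⊆ S, Dense G K → 5 ≤ #K) → (∀ v ∈ S, s + 1 ≤ dg G S v) → Pack G S s := by
  induction s with
  | zero => intros; trivial
  | succ s ih =>
    intro S h0 h5 hd
    have hS : Dense G S := by
      by_contra h
      obtain ⟨v, hv, h1⟩ := exists_leaf h h0
      have := hd v hv
      omega
    obtain ⟨D, hDS, hD, hmin⟩ := exists_min_dense Subset.rfl hS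
    refine Pack.cons hDS hD ?_
    rcases Nat.eq_zero_or_pos s with rfl | hs
    · trivial
    refine ih _ ?_ (fun K hK => h5 K (hK.trans sdiff_subset)) ?_
    · rw [sdiff_nonempty]
      intro hSD
      obtain rfl := hDS.antisymm hSD
      have hm : ∀ x ∈ D, ¬ Dense G (D.erase x) := fun x hx h1 => by
        have := hmin _ (erase_subset _ _) h1
        rw [card_erase_of_mem hx] at this
        have := card_pos.2 ⟨x, hx⟩
        omega
      obtain ⟨v, hv⟩ := h0
      have := (dg_eq_two_of_min hD hm).2 v hv
      have := hd v hv
      omega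
    · intro v hv
      rw [mem_sdiff] at hv
      have := one_neighbour hDS hD hmin (h5 D hDS hD) hv.1 hv.2
      have := dg_sdiff (G := G) hDS v
      have := hd v hv.1
      omega

/-- The graph in which `u` inherits the neighbours of `v`. -/
def ctr (G : SimpleGraph V) (v u : V) : SimpleGraph V where
  Adj x y := x ≠ y ∧ (G.Adj x y ∨ (x = u ∧ G.Adj v y) ∨ (y = u ∧ G.Adj v x))
  symm := ⟨fun x y h => ⟨h.1.symm, by
    rcases h.2 with h | h | h
    · exact Or.inl h.symm
    · exact Or.inr (Or.inr h)
    · exact Or.inr (Or.inl h)⟩⟩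
  loopless := ⟨fun x h => h.1 rfl⟩

lemma ad_ctr_of_ne {v u x y : V} (hx : x ≠ u) (hy : y ≠ u) : ad (ctr G v u) x y = ad G x y := by
  have : (ctr G v u).Adj x y ↔ G.Adj x y := by
    simp only [ctr, hx, hy, false_and, or_false]
    exact ⟨fun h => h.2, fun h => ⟨h.ne, h⟩⟩
  simp [ad, this]

lemma ad_ctr_left {v u y : V} (hy : y ≠ u) (hc : G.Adj v y → ¬ G.Adj u y) :
    ad (ctr G v u) u y = ad G u y + ad G v y := by
  have : (ctr G v u).Adj u y ↔ G.Adj u y ∨ G.Adj v y := by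
    simp only [ctr, hy, false_and, or_false, true_and]
    exact ⟨fun h => h.2, fun h => ⟨hy.symm, h⟩⟩
  by_cases h1 : G.Adj u y <;> by_cases h2 : G.Adj v y <;> simp [ad, this, h1, h2]
  exact hc h2 h1

lemma dg_ctr_of_notMem {v u x : V} {K : Finset V} (hu : u ∉ K) (hx : x ≠ u) :
    dg (ctr G v u) K x = dg G K x :=
  sum_congr rfl fun y hy => ad_ctr_of_ne hx (by rintro rfl; exact hu hy)

lemma ed_ctr_of_notMem {v u : V} {K : Finset V} (hu : u ∉ K) :
    ed (ctr G v u) K = ed G K := by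
  unfold ed
  rw [sum_congr rfl fun x hx => dg_ctr_of_notMem hu (by rintro rfl; exact hu hx)]

lemma dg_ctr_self {v u : V} {K : Finset V} (hc : ∀ y ∈ K, G.Adj v y → ¬ G.Adj u y) :
    dg (ctr G v u) K u = dg G K u + dg G (K.erase u) v := by
  rw [← dg_erase_self, ← dg_erase_self (G := G)]
  simp only [dg, ← sum_add_distrib]
  exact sum_congr rfl fun y hy =>
    ad_ctr_left (mem_erase.1 hy).1 (hc y (mem_erase.1 hy).2)

lemma ed_ctr_of_mem {v u : V} {K : Finset V} (hu : u ∈ K)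
    (hc : ∀ y ∈ K, G.Adj v y → ¬ G.Adj u y) :
    ed (ctr G v u) K = ed G K + dg G (K.erase u) v := by
  rw [← ed_erase hu, ← ed_erase (G := G) hu, dg_ctr_self hc, ed_ctr_of_notMem (notMem_erase _ _)]
  omega

lemma dense_of_ctr_of_notMem {v u : V} {K : Finset V} (hu : u ∉ K) (h : Dense (ctr G v u) K) :
    Dense G K := ⟨h.1, by have := h.2; rwa [ed_ctr_of_notMem hu] at this⟩

lemma dense_insert_of_ctr {v u : V} {K : Finset V} (huv : G.Adj v u) (hv : v ∉ K) (hu : u ∈ K)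
    (hc : ∀ y ∈ K, G.Adj v y → ¬ G.Adj u y) (h : Dense (ctr G v u) K) :
    Dense G (insert v K) := by
  refine Dense.insert hv ?_
  have h1 := h.2
  rw [ed_ctr_of_mem hu hc] at h1
  have := dg_erase (G := G) hu v
  rw [ad_of_adj huv] at this
  omega

lemma Pack.of_ctr_of_notMem {v u : V} {k : ℕ} : ∀ {T : Finset V}, u ∉ T →
    Pack (ctr G v u) T k → Pack G T k := by
  induction k with
  | zero => intros; trivial
  | succ k ih =>
    rintro T hu ⟨K, hK, hd, hp⟩
    exact ⟨K, hK, dense_of_ctr_of_notMem (fun h => hu (hK h)) hd,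
      ih (fun h => hu (sdiff_subset h)) hp⟩

lemma Pack.of_ctr {v u : V} (huv : G.Adj v u) {k : ℕ} : ∀ {T : Finset V}, v ∉ T →
    (∀ y ∈ T, G.Adj v y → ¬ G.Adj u y) → Pack (ctr G v u) T k → Pack G (insert v T) k := by
  induction k with
  | zero => intros; trivial
  | succ k ih =>
    rintro T hv hc ⟨K, hK, hd, hp⟩
    by_cases hu : u ∈ K
    · refine ⟨insert v K, insert_subset_insert _ hK,
        dense_insert_of_ctr huv (fun h => hv (hK h)) hu (fun y hy => hc y (hK hy)) hd, ?_⟩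
      refine (hp.of_ctr_of_notMem (by simp [hu])).mono fun x hx => ?_
      rw [mem_sdiff] at hx
      simp only [mem_sdiff, mem_insert, not_or]
      exact ⟨Or.inr hx.1, by rintro rfl; exact hv hx.1, hx.2⟩
    · refine ⟨K, hK.trans (subset_insert _ _), dense_of_ctr_of_notMem hu hd, ?_⟩
      refine (ih (fun h => hv (sdiff_subset h)) (fun y hy => hc y (sdiff_subset hy)) hp).mono ?_
      intro x hx
      rw [mem_insert, mem_sdiff] at hx
      rw [mem_sdiff, mem_insert]
      rcases hx with rfl | hx
      · exact ⟨Or.inl rfl, fun h => hv (hK h)⟩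
      · exact ⟨Or.inr hx.1, hx.2⟩

lemma dg_ctr_erase_of_ne {S : Finset V} {v u x : V} (hv : v ∈ S) (hu : u ∈ S)
    (huv : G.Adj v u) (hc : ∀ y ∈ S, G.Adj v y → ¬ G.Adj u y) (hx : x ∈ S)
    (hxu : x ≠ u) :
    dg (ctr G v u) (S.erase v) x = dg G S x := by
  have hu' : u ∈ S.erase v := mem_erase.2 ⟨huv.ne', hu⟩
  rw [← dg_erase hu', ← dg_erase (G := G) hv, ← dg_erase (G := G) hu',
    dg_ctr_of_notMem (notMem_erase _ _) hxu, ad_comm, ad_ctr_left hxu (hc x hx),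
    ad_comm x u, ad_comm x v]
  omega

lemma dg_ctr_erase_self {S : Finset V} {v u : V} (hv : v ∈ S) (hu : u ∈ S)
    (huv : G.Adj v u) (hc : ∀ y ∈ S, G.Adj v y → ¬ G.Adj u y) :
    dg (ctr G v u) (S.erase v) u + 2 = dg G S u + dg G S v := by
  have hu' : u ∈ S.erase v := mem_erase.2 ⟨huv.ne', hu⟩
  rw [dg_ctr_self (fun y hy => hc y (mem_of_mem_erase hy)), ← dg_erase (G := G) hv u,
    ← dg_erase_self (G := G) S v, ← dg_erase hu' v, ad_of_adj huv, ad_of_adj huv.symm]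
  omega

lemma pack_of_potential (n : ℕ) : ∀ (G : SimpleGraph V) (S : Finset V) (φ : V → ℤ) (s : ℕ),
    #S ≤ n → (∀ K ⊆ S, Dense G K → 5 ≤ #K) → (∀ v ∈ S, φ v ≤ 2) →
    (∀ v ∈ S, φ v ≤ -1 ∨ (s : ℤ) + 1 + φ v ≤ dg G S v) → 1 ≤ s →
    7 * (s : ℤ) - 6 ≤ ∑ v ∈ S, φ v → Pack G S s := by
  induction n with
  | zero =>
    intro G S φ s hn _ _ _ hs hsum
    rw [Nat.le_zero, card_eq_zero] at hn
    subst hn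
    simp at hsum
    omega
  | succ n ih =>
    intro G S φ s hn h5 h2 hφ hs hsum
    by_cases hlow : ∃ v ∈ S, φ v ≤ -1
    · obtain ⟨v, hv, hv1⟩ := hlow
      have hcard : #(S.erase v) ≤ n := by rw [card_erase_of_mem hv]; omega
      have hsumv := add_sum_erase S φ hv
      rcases Nat.lt_or_ge (dg G S v) 2 with hdv | hdv
      · refine (ih G (S.erase v) (fun x => φ x - ad G v x) s hcard
          (fun K hK => h5 K (hK.trans (erase_subset _ _))) ?_ ?_ hs ?_).mono (erase_subset _ _)
        · intro x hx
          have := h2 x (mem_of_mem_erase hx)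
          omega
        · intro x hx
          have h := dg_erase (G := G) hv x
          rw [ad_comm] at h
          rcases hφ x (mem_of_mem_erase hx) with h1 | h1
          · left; omega
          · right; omega
        · rw [sum_sub_distrib]
          have : ∑ x ∈ S.erase v, (ad G v x : ℤ) = dg G S v := by
            rw [← dg_erase_self, dg]; push_cast; rfl
          omega
      by_cases hD : ∃ D ⊆ S, Dense G D ∧ #D = 5 ∧ v ∈ D
      · obtain ⟨D, hDS, hDd, hD5, hvD⟩ := hD
        obtain ⟨s, rfl⟩ : ∃ t, s = t + 1 := ⟨s - 1, by omega⟩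
        refine Pack.cons hDS hDd ?_
        rcases Nat.eq_zero_or_pos s with rfl | hs'
        · trivial
        have hmin : ∀ K ⊆ S, Dense G K → #D ≤ #K := fun K hK hKd => by
          rw [hD5]; exact h5 K hK hKd
        have h0 : #(S \ D) ≤ n := by
          have := card_sdiff_add_card_eq_card hDS
          omega
        have hsumD : ∑ x ∈ D, φ x ≤ 7 := by
          have h1 := add_sum_erase D φ hvD
          have h3 : ∑ x ∈ D.erase v, φ x ≤ ∑ x ∈ D.erase v, (2 : ℤ) :=
            sum_le_sum fun x hx => h2 x (hDS (mem_of_mem_erase hx))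
          rw [sum_const, card_erase_of_mem hvD, hD5] at h3
          simp at h3
          omega
        have hsd := sum_sdiff (f := φ) hDS
        refine ih G (S \ D) φ s h0 (fun K hK => h5 K (hK.trans sdiff_subset))
          (fun x hx => h2 x (sdiff_subset hx)) (fun x hx => ?_) hs' (by push_cast at hsum; omega)
        rw [mem_sdiff] at hx
        have h1 := one_neighbour hDS hDd hmin (by omega) hx.1 hx.2
        have h3 := dg_sdiff (G := G) hDS x
        rcases hφ x hx.1 with h | h
        · exact Or.inl h
        · right; push_cast at h; omega
      · have hD' : ∀ D ⊆ S, Dense G D → v ∈ D → 6 ≤ #D := fun D h1 h3 h4 => by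
          have := h5 D h1 h3
          by_contra h6
          exact hD ⟨D, h1, h3, by omega, h4⟩
        obtain ⟨u, hu, huv⟩ := exists_adj_of_dg_pos (by omega : 0 < dg G S v)
        have hc : ∀ y ∈ S, G.Adj v y → ¬ G.Adj u y := fun y hy h1 h3 => by
          have := h5 {v, u, y} (by simp [insert_subset_iff, hv, hu, hy]) (dense_triple huv h3 h1)
          have := card_le_three (a := v) (b := u) (c := y)
          omega
        have := Pack.of_ctr huv (notMem_erase v S) (fun y hy => hc y (mem_of_mem_erase hy))
          (ih (ctr G v u) (S.erase v) φ s hcard ?_ (fun x hx => h2 x (mem_of_mem_erase hx)) ?_ hs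
            (by omega))
        · rwa [insert_erase hv] at this
        · intro K hK hKd
          have hKS := hK.trans (erase_subset _ _)
          by_cases huK : u ∈ K
          · have hvK : v ∉ K := fun h => notMem_erase _ _ (hK h)
            have := hD' (insert v K) (insert_subset hv hKS)
              (dense_insert_of_ctr huv hvK huK (fun y hy => hc y (hKS hy)) hKd)
              (mem_insert_self _ _)
            rw [card_insert_of_notMem hvK] at this
            omega
          · exact h5 K hKS (dense_of_ctr_of_notMem huK hKd)
        · intro x hx
          rw [mem_erase] at hx
          have h1 := hφ x hx.2
          by_cases hxu : x = u
          · subst hxu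
            have := dg_ctr_erase_self hv hu huv hc
            omega
          · rwa [dg_ctr_erase_of_ne hv hu huv hc hx.2 hxu]
    · push Not at hlow
      have h0 : S.Nonempty := by
        rw [nonempty_iff_ne_empty]
        rintro rfl
        rw [sum_empty] at hsum
        omega
      refine pack_of_min_degree s S h0 h5 fun v hv => ?_
      have := hlow v hv
      have := hφ v hv
      omega

/-- A set that becomes dense after adding a vertex joined to it by `∑ ν` edges. -/
def CDense (G : SimpleGraph V) (ν : V → ℕ) (K : Finset V) : Prop :=
  #K + 1 ≤ ed G K + ∑ x ∈ K, ν x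

lemma sum_shift (ν : V → ℕ) (v : V) (K : Finset V) :
    ∑ x ∈ K, (ν x + ν v * ad G v x) = ∑ x ∈ K, ν x + ν v * dg G K v := by
  rw [sum_add_distrib, ← mul_sum, dg]

lemma CDense.unshift {ν : V → ℕ} {v : V} {K : Finset V} (hv : v ∉ K) (h1 : dg G K v ≤ 1)
    (h : CDense G (fun x => ν x + ν v * ad G v x) K) :
    ∃ K', K ⊆ K' ∧ K' ⊆ insert v K ∧ (dg G K v = 0 → K' = K) ∧ CDense G ν K' := by
  unfold CDense at h
  rw [sum_shift] at h
  rcases Nat.eq_zero_or_pos (dg G K v) with h0 | h0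
  · refine ⟨K, Subset.rfl, subset_insert _ _, fun _ => rfl, ?_⟩
    rw [h0] at h
    exact h
  · have h2 : dg G K v = 1 := by omega
    refine ⟨insert v K, subset_insert _ _, Subset.rfl, fun h => by omega, ?_⟩
    unfold CDense
    rw [card_insert_of_notMem hv, ed_insert hv, sum_insert hv, h2]
    rw [h2] at h
    omega

lemma CDense.shift {ν : V → ℕ} {v : V} {K : Finset V} (h1 : v ∈ K → dg G K v ≤ 1)
    (hν : ν v ≤ 1) (h : CDense G ν K) :
    CDense G (fun x => ν x + ν v * ad G v x) (K.erase v) := by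
  unfold CDense at *
  rw [sum_shift, dg_erase_self]
  by_cases hv : v ∈ K
  · have h2 := h1 hv
    have h3 := ed_erase (G := G) hv
    have h4 := add_sum_erase K ν hv
    have h5 := card_pos.2 ⟨v, hv⟩
    rw [card_erase_of_mem hv]
    interval_cases h6 : dg G K v <;> omega
  · rw [erase_eq_of_notMem hv]
    omega

lemma cdense_singleton {ν : V → ℕ} {v : V} (h : 2 ≤ ν v) : CDense G ν {v} := by
  simpa [CDense] using h

lemma not_cdense_empty {ν : V → ℕ} : ¬ CDense G ν ∅ := by simp [CDense]

lemma exists_center (n : ℕ) : ∀ (Y : Finset V) (ν μ : V → ℕ), #Y = n → Y.Nonempty →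
    (∀ K ⊆ Y, ¬ Dense G K) →
    (∀ K ⊆ Y, ∀ K' ⊆ Y, Disjoint K K' → CDense G ν K → ¬ CDense G μ K') →
    ∃ s ∈ Y, (∀ K ⊆ Y.erase s, ¬ CDense G ν K) ∨ (∀ K ⊆ Y.erase s, ¬ CDense G μ K) := by
  induction n with
  | zero =>
    intro Y _ _ h h0
    rw [card_eq_zero.1 h] at h0
    simp at h0
  | succ n ih =>
    intro Y ν μ hn h0 hY hdis
    obtain ⟨v, hv, hv1⟩ := exists_leaf (hY Y Subset.rfl) h0
    by_cases hν : 2 ≤ ν v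
    · refine ⟨v, hv, Or.inr fun K hK => hdis {v} (by simpa using hv) K
        (hK.trans (erase_subset _ _)) ?_ (cdense_singleton hν)⟩
      rw [disjoint_singleton_left]
      exact fun h => notMem_erase _ _ (hK h)
    by_cases hμ : 2 ≤ μ v
    · refine ⟨v, hv, Or.inl fun K hK hc => hdis K (hK.trans (erase_subset _ _)) {v}
        (by simpa using hv) ?_ hc (cdense_singleton hμ)⟩
      rw [disjoint_singleton_right]
      exact fun h => notMem_erase _ _ (hK h)
    have hcard : #(Y.erase v) = n := by rw [card_erase_of_mem hv]; omega
    rcases (Y.erase v).eq_empty_or_nonempty with he | he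
    · refine ⟨v, hv, Or.inl fun K hK => ?_⟩
      rw [he, subset_empty] at hK
      subst hK
      exact not_cdense_empty
    obtain ⟨s, hs, h⟩ := ih (Y.erase v) (fun x => ν x + ν v * ad G v x)
      (fun x => μ x + μ v * ad G v x) hcard he
      (fun K hK => hY K (hK.trans (erase_subset _ _))) (by
        intro K hK K' hK' hd hc hc'
        have hvK : v ∉ K := fun h => notMem_erase _ _ (hK h)
        have hvK' : v ∉ K' := fun h => notMem_erase _ _ (hK' h)
        have h1 := dg_mono (G := G)
          (union_subset (hK.trans (erase_subset _ _)) (hK'.trans (erase_subset _ _))) v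
        rw [dg_union hd] at h1
        obtain ⟨L, l1, l2, l3, l4⟩ := hc.unshift hvK (by omega)
        obtain ⟨L', l1', l2', l3', l4'⟩ := hc'.unshift hvK' (by omega)
        have hLY : L ⊆ Y := l2.trans (insert_subset hv (hK.trans (erase_subset _ _)))
        have hLY' : L' ⊆ Y := l2'.trans (insert_subset hv (hK'.trans (erase_subset _ _)))
        refine hdis L hLY L' hLY' ?_ l4 l4'
        rcases (by omega : dg G K v = 0 ∨ dg G K' v = 0) with h2 | h2
        · rw [l3 h2]
          refine disjoint_of_subset_right l2' ?_
          rw [disjoint_insert_right]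
          exact ⟨hvK, hd⟩
        · rw [l3' h2]
          refine disjoint_of_subset_left l2 ?_
          rw [disjoint_insert_left]
          exact ⟨hvK', hd⟩)
    refine ⟨s, mem_of_mem_erase hs, ?_⟩
    have hsub : ∀ K ⊆ Y.erase s, K.erase v ⊆ (Y.erase v).erase s := fun K hK => by
      rw [erase_right_comm]
      exact erase_subset_erase _ hK
    have hle : ∀ K ⊆ Y.erase s, dg G K v ≤ 1 := fun K hK =>
      (dg_mono (hK.trans (erase_subset _ _)) v).trans hv1
    refine h.imp (fun h K hK hc => h _ (hsub K hK) ?_) (fun h K hK hc => h _ (hsub K hK) ?_)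
    · exact hc.shift (fun _ => hle K hK) (by omega)
    · exact hc.shift (fun _ => hle K hK) (by omega)

lemma sum_dg_erase {Y : Finset V} {s : V} (hs : s ∈ Y) :
    ∑ x ∈ Y.erase s, dg G Y x = ed G (Y.erase s) + ed G Y := by
  have h1 := two_mul_ed (G := G) Y
  have h2 := add_sum_erase Y (dg G Y) hs
  have h3 := ed_erase (G := G) hs
  omega

lemma sum_ad (A : Finset V) (c : V) : ∑ x ∈ A, ad G x c = dg G A c :=
  sum_congr rfl fun _ _ => ad_comm _ _

lemma CDense.dense_insert {K : Finset V} {a : V} (ha : a ∉ K) (h : CDense G (ad G a) K) :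
    Dense G (insert a K) := Dense.insert ha h

lemma CDense.dense_insert_insert {K : Finset V} {a b : V} (ha : a ∉ K) (hb : b ∉ K)
    (hab : G.Adj a b) (h : CDense G (fun x => ad G a x + ad G b x) K) :
    Dense G (insert a (insert b K)) := by
  unfold CDense at h
  rw [sum_add_distrib] at h
  have haK : a ∉ insert b K := by simp [ha, hab.ne]
  refine ⟨insert_nonempty _ _, ?_⟩
  rw [card_insert_of_notMem haK, ed_insert haK, card_insert_of_notMem hb, ed_insert hb,
    dg_insert hb, ad_of_adj hab]
  change _ ≤ ed G K + (dg G K a + dg G K b) at h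
  omega

/-- Swapping a vertex of a minimal dense set for one with two neighbours in the rest. -/
lemma swap_dense {C : Finset V} (hC : Dense G C) (hm : ∀ x ∈ C, ¬ Dense G (C.erase x))
    {v c : V} (hv : v ∉ C) (hc : c ∈ C) (h : 2 ≤ dg G (C.erase c) v) :
    Dense G (insert v (C.erase c)) := by
  obtain ⟨h1, h2⟩ := dg_eq_two_of_min hC hm
  have h3 := ed_erase (G := G) hc
  have h4 := h2 c hc
  have h5 := three_le_card hC
  refine Dense.insert (fun h => hv (mem_of_mem_erase h)) ?_
  rw [card_erase_of_mem hc]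
  omega

/-- The contribution of a vertex of degree `d` to `|H| - |L|` when `k = 2`. -/
def tau (d : ℕ) : ℤ := if 4 ≤ d then 1 else if d = 3 then 0 else -1

/-- A lower bound used as a size condition when `k = 2`. -/
def alp (d : ℕ) : ℤ := if 4 ≤ d then 4 else if d = 3 then 2 else if d = 2 then 0 else -2

lemma tau_le {d : ℕ} (h : 2 ≤ d) : tau d ≤ d - 3 := by unfold tau; split_ifs <;> omega

lemma tau_le_one (d : ℕ) : tau d ≤ 1 := by unfold tau; split_ifs <;> omega

lemma sum_tau_le {A : Finset V} {f : V → ℕ} (hf : ∀ x ∈ A, 2 ≤ f x) :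
    ∑ x ∈ A, tau (f x) ≤ ∑ x ∈ A, (f x : ℤ) - 3 * #A := by
  have h : ∑ x ∈ A, tau (f x) ≤ ∑ x ∈ A, ((f x : ℤ) - 3) := sum_le_sum fun x hx => tau_le (hf x hx)
  rw [sum_sub_distrib, sum_const, nsmul_eq_mul] at h
  linarith

lemma pack_two_triangle {S : Finset V} {a b c : V} (ha : a ∈ S) (hb : b ∈ S) (hc : c ∈ S)
    (hab : G.Adj a b) (hbc : G.Adj b c) (hac : G.Adj a c)
    (h1 : dg G (S \ {a, b, c}) c ≤ 1) (h4 : 4 ≤ #S)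
    (hdeg : ∀ x ∈ S, 2 ≤ dg G S x) (hτ : 4 ≤ ∑ x ∈ S, tau (dg G S x)) :
    Pack G S 2 := by
  by_contra hP
  have hCS : ({a, b, c} : Finset V) ⊆ S := by simp [insert_subset_iff, ha, hb, hc]
  have hCd : Dense G {a, b, c} := dense_triple hab hbc hac
  have hCc : #({a, b, c} : Finset V) = 3 := by
    rw [card_eq_three]; exact ⟨a, b, c, hab.ne, hac.ne, hbc.ne, rfl⟩
  obtain ⟨Y, hYdef⟩ : ∃ Y, S \ {a, b, c} = Y := ⟨_, rfl⟩
  rw [hYdef] at h1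
  have hYS : Y ⊆ S := hYdef ▸ sdiff_subset
  have hYc := card_sdiff_add_card_eq_card hCS
  rw [hYdef] at hYc
  have hY0 : Y.Nonempty := card_pos.1 (by omega)
  have hYa : ∀ K ⊆ Y, ¬ Dense G K := fun K hK hd =>
    hP (Pack.two hCS (hK.trans hYS) hCd hd (disjoint_sdiff.mono_right (hYdef ▸ hK)))
  have hYn : ∀ x ∈ Y, x ≠ a ∧ x ≠ b ∧ x ≠ c := fun x hx => by
    rw [← hYdef, mem_sdiff] at hx; simpa using hx.2
  have hdg : ∀ x, dg G S x = dg G Y x + (ad G x a + ad G x b + ad G x c) := fun x => by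
    rw [← dg_sdiff hCS, hYdef, dg_insert (by simp [hab.ne, hac.ne]), dg_insert (by simp [hbc.ne]),
      dg_singleton]
    omega
  have hedY := ed_lt_of_not_dense (hYa Y Subset.rfl) hY0
  have hτY : 2 ≤ ∑ x ∈ Y, tau (dg G S x) := by
    have h := sum_sdiff (f := fun x => tau (dg G S x)) hCS
    rw [sum_insert (by simp [hab.ne, hac.ne]), sum_insert (by simp [hbc.ne]),
      sum_singleton, hYdef] at h
    have t1 := tau_le_one (dg G S a)
    have t2 := tau_le_one (dg G S b)
    have t3 := tau_le (hdeg c hc)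
    have t4 := hdg c
    have t5 := ad_le_one (G := G) c a
    have t6 := ad_le_one (G := G) c b
    rw [ad_self] at t4
    omega
  -- the two choices of the apex are symmetric
  have key : ∀ a b : V, a ∈ S → b ∈ S → a ∉ Y → b ∉ Y → a ≠ b → a ≠ c → G.Adj b c →
      (∀ x, dg G S x = dg G Y x + (ad G x a + ad G x b + ad G x c)) →
      ∀ s ∈ Y, ¬ ∀ K ⊆ Y.erase s, ¬ CDense G (ad G a) K := by
    intro a b ha hb haY hbY hab hac hbc hdg s hs hcon
    have hcY : c ∉ Y := fun h => (hYn c h).2.2 rfl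
    have e1 := hcon (Y.erase s) Subset.rfl
    unfold CDense at e1
    change ¬ _ ≤ _ + dg G (Y.erase s) a at e1
    have e2 : ∑ x ∈ Y.erase s, dg G S x = ed G (Y.erase s) + ed G Y +
        (dg G (Y.erase s) a + dg G (Y.erase s) b + dg G (Y.erase s) c) := by
      simp only [hdg, sum_add_distrib, sum_ad, sum_dg_erase hs]
    have e3 := dg_le_card (G := G) (Y.erase s) b
    have e4 := dg_erase (G := G) hs c
    have e5 := sum_tau_le fun x hx => hdeg x (hYS (mem_of_mem_erase (a := s) hx))
    have e6 := add_sum_erase Y (fun x => tau (dg G S x)) hs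
    have e7 := tau_le_one (dg G S s)
    have e8 : #(Y.erase s) = #Y - 1 := card_erase_of_mem hs
    have e2' : ∑ x ∈ Y.erase s, (dg G S x : ℤ) = (ed G (Y.erase s) + ed G Y +
        (dg G (Y.erase s) a + dg G (Y.erase s) b + dg G (Y.erase s) c) : ℕ) := by
      rw [← e2]; push_cast; rfl
    have f1 : 4 ≤ dg G S s := by
      by_contra h
      have : tau (dg G S s) ≤ 0 := by have := tau_le (hdeg s (hYS hs)); omega
      omega
    have f2 : dg G (Y.erase s) c = 1 := by omega
    have f3 : dg G (Y.erase s) b = #(Y.erase s) := by omega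
    have f4 : ad G s c = 0 := by rw [ad_comm]; omega
    obtain ⟨z, hz, hcz⟩ := exists_adj_of_dg_pos (by omega : 0 < dg G (Y.erase s) c)
    have hzY := mem_of_mem_erase hz
    have hbz : G.Adj b z := by
      rw [dg_eq_card, card_filter_eq_iff] at f3
      exact f3 z hz
    have f5 : dg G S z ≤ 4 := by
      have g1 := add_sum_erase (Y.erase s) (fun x => tau (dg G S x)) hz
      have g2 := add_sum_erase (Y.erase s) (fun x => (dg G S x : ℤ)) hz
      have g3 := sum_tau_le fun x hx => hdeg x (hYS (mem_of_mem_erase (a := s)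
        (mem_of_mem_erase (a := z) hx)))
      have g4 := card_erase_of_mem hz
      have g5 := tau_le_one (dg G S z)
      have g6 := card_pos.2 ⟨z, hz⟩
      omega
    have hsub : Y.erase z ⊆ S := (erase_subset _ _).trans hYS
    have f6 : ¬ CDense G (ad G a) (Y.erase z) := fun h => by
      refine hP (Pack.two (insert_subset ha hsub) (?_ : ({z, b, c} : Finset V) ⊆ S)
        (h.dense_insert fun h => haY (mem_of_mem_erase h)) (dense_triple hbz.symm hbc hcz.symm) ?_)
      · simp [insert_subset_iff, hYS hzY, hb, hc]
      · have : a ≠ z := by rintro rfl; exact haY hzY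
        simp [hab.symm, hac.symm, this.symm, hbY, hcY]
    unfold CDense at f6
    change ¬ _ ≤ _ + dg G (Y.erase z) a at f6
    have g1 := ed_erase (G := G) hs
    have g2 := ed_erase (G := G) hzY
    have g3 := dg_erase (G := G) hs a
    have g4 := dg_erase (G := G) hzY a
    have g5 : #(Y.erase z) = #Y - 1 := card_erase_of_mem hzY
    have g6 := hdg s
    have g7 := hdg z
    rw [ad_of_adj hbz.symm, ad_of_adj hcz.symm, ad_comm z a] at g7
    rw [f4, ad_comm s a] at g6
    have g8 := ad_le_one (G := G) s b
    omega
  have haY : a ∉ Y := fun h => (hYn a h).1 rfl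
  have hbY : b ∉ Y := fun h => (hYn b h).2.1 rfl
  obtain ⟨s, hs, h | h⟩ := exists_center (G := G) _ Y (ad G a) (ad G b) rfl hY0 hYa
    (fun K hK K' hK' hd hc hc' => hP (Pack.two (insert_subset ha (hK.trans hYS))
      (insert_subset hb (hK'.trans hYS)) (hc.dense_insert fun h => haY (hK h))
      (hc'.dense_insert fun h => hbY (hK' h)) (by
        have h1 : a ∉ K' := fun h => haY (hK' h)
        have h2 : b ∉ K := fun h => hbY (hK h)
        simp [disjoint_insert_left, disjoint_insert_right, h1, h2, hab.ne', hd])))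
  · exact key a b ha hb haY hbY hab.ne hac.ne hbc hdg s hs h
  · exact key b a hb ha hbY haY hab.ne' hbc.ne hac (fun x => by rw [hdg x]; omega) s hs h

lemma pack_two_square {S : Finset V} {a b c d : V} (ha : a ∈ S) (hb : b ∈ S) (hc : c ∈ S)
    (hd : d ∈ S) (hab : G.Adj a b) (hbc : G.Adj b c) (hcd : G.Adj c d) (hda : G.Adj d a)
    (hac : a ≠ c) (hbd : b ≠ d) (h3 : ∀ K ⊆ S, Dense G K → 4 ≤ #K)
    (h1 : dg G (S \ {a, b, c, d}) b ≤ 1) (h2 : dg G (S \ {a, b, c, d}) d ≤ 1) (h4 : 5 ≤ #S)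
    (hdeg : ∀ x ∈ S, 2 ≤ dg G S x)
    (hτ : 4 ≤ ∑ x ∈ S, tau (dg G S x)) : Pack G S 2 := by
  by_contra hP
  have htri : ∀ x ∈ S, ∀ y ∈ S, ∀ z ∈ S, G.Adj x y → G.Adj y z → ¬ G.Adj x z := by
    intro x hx y hy z hz e1 e2 e3
    have := h3 {x, y, z} (by simp [insert_subset_iff, hx, hy, hz]) (dense_triple e1 e2 e3)
    have := card_le_three (a := x) (b := y) (c := z)
    omega
  have hCS : ({a, b, c, d} : Finset V) ⊆ S := by simp [insert_subset_iff, ha, hb, hc, hd]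
  have hCd : Dense G {a, b, c, d} := dense_quad hab hbc hcd hda hac hbd
  have n1 : a ∉ ({b, c, d} : Finset V) := by simp [hab.ne, hac, hda.ne']
  have n2 : b ∉ ({c, d} : Finset V) := by simp [hbc.ne, hbd]
  have n3 : c ∉ ({d} : Finset V) := by simp [hcd.ne]
  have hCc : #({a, b, c, d} : Finset V) = 4 := by
    rw [card_insert_of_notMem n1, card_insert_of_notMem n2, card_insert_of_notMem n3,
      card_singleton]
  obtain ⟨Y, hYdef⟩ : ∃ Y, S \ {a, b, c, d} = Y := ⟨_, rfl⟩
  rw [hYdef] at h1 h2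
  have hYS : Y ⊆ S := hYdef ▸ sdiff_subset
  have hYc := card_sdiff_add_card_eq_card hCS
  rw [hYdef] at hYc
  have hY0 : Y.Nonempty := card_pos.1 (by omega)
  have hYa : ∀ K ⊆ Y, ¬ Dense G K := fun K hK hd =>
    hP (Pack.two hCS (hK.trans hYS) hCd hd (disjoint_sdiff.mono_right (hYdef ▸ hK)))
  have hYn : ∀ x ∈ Y, x ≠ a ∧ x ≠ b ∧ x ≠ c ∧ x ≠ d := fun x hx => by
    rw [← hYdef, mem_sdiff] at hx; simpa using hx.2
  have hdg : ∀ x, dg G S x = dg G Y x + (ad G x a + ad G x b + (ad G x c + ad G x d)) :=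
    fun x => by
    rw [← dg_sdiff hCS, hYdef, dg_insert n1, dg_insert n2, dg_insert n3, dg_singleton]
    omega
  have hedY := ed_lt_of_not_dense (hYa Y Subset.rfl) hY0
  have hbd' : ¬ G.Adj b d := htri b hb a ha d hd hab.symm hda.symm
  have hτY : 2 ≤ ∑ x ∈ Y, tau (dg G S x) := by
    have h := sum_sdiff (f := fun x => tau (dg G S x)) hCS
    rw [sum_insert n1, sum_insert n2, sum_insert n3, sum_singleton, hYdef] at h
    have t1 := tau_le_one (dg G S a)
    have t2 := tau_le_one (dg G S c)
    have t3 := tau_le (hdeg b hb)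
    have t4 := tau_le (hdeg d hd)
    have t5 := hdg b
    have t6 := hdg d
    have t7 := ad_le_one (G := G) b a
    have t8 := ad_le_one (G := G) b c
    have t9 := ad_le_one (G := G) d a
    have t10 := ad_le_one (G := G) d c
    rw [ad_self, ad_of_not_adj hbd'] at t5
    rw [ad_self, ad_comm d b, ad_of_not_adj hbd'] at t6
    omega
  have key : ∀ a b c d : V, c ∈ S → d ∈ S → G.Adj c d → dg G Y d ≤ 1 →
      (∀ x, dg G S x = dg G Y x + (ad G x a + ad G x b + (ad G x c + ad G x d))) →
      ∀ s ∈ Y, ¬ ∀ K ⊆ Y.erase s, ¬ CDense G (fun x => ad G a x + ad G b x) K := by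
    intro a b c d hc hd hcd hdY hdg s hs hcon
    have e1 := hcon (Y.erase s) Subset.rfl
    unfold CDense at e1
    rw [sum_add_distrib] at e1
    change ¬ _ ≤ _ + (dg G (Y.erase s) a + dg G (Y.erase s) b) at e1
    have e2 : ∑ x ∈ Y.erase s, dg G S x = ed G (Y.erase s) + ed G Y +
        (dg G (Y.erase s) a + dg G (Y.erase s) b +
          (dg G (Y.erase s) c + dg G (Y.erase s) d)) := by
      simp only [hdg, sum_add_distrib, sum_ad, sum_dg_erase hs]
    have e3 := dg_le_card (G := G) (Y.erase s) c
    have e4 := dg_erase (G := G) hs d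
    have e5 := sum_tau_le fun x hx => hdeg x (hYS (mem_of_mem_erase (a := s) hx))
    have e6 := add_sum_erase Y (fun x => tau (dg G S x)) hs
    have e7 := tau_le_one (dg G S s)
    have e8 : #(Y.erase s) = #Y - 1 := card_erase_of_mem hs
    have e2' : ∑ x ∈ Y.erase s, (dg G S x : ℤ) = (ed G (Y.erase s) + ed G Y +
        (dg G (Y.erase s) a + dg G (Y.erase s) b +
          (dg G (Y.erase s) c + dg G (Y.erase s) d)) : ℕ) := by
      rw [← e2]; push_cast; rfl
    have f2 : dg G (Y.erase s) d = 1 := by omega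
    have f3 : dg G (Y.erase s) c = #(Y.erase s) := by omega
    obtain ⟨z, hz, hdz⟩ := exists_adj_of_dg_pos (by omega : 0 < dg G (Y.erase s) d)
    have hcz : G.Adj c z := by
      rw [dg_eq_card, card_filter_eq_iff] at f3
      exact f3 z hz
    exact htri c hc d hd z (hYS (mem_of_mem_erase hz)) hcd hdz hcz
  have haY : a ∉ Y := fun h => (hYn a h).1 rfl
  have hbY : b ∉ Y := fun h => (hYn b h).2.1 rfl
  have hcY : c ∉ Y := fun h => (hYn c h).2.2.1 rfl
  have hdY : d ∉ Y := fun h => (hYn d h).2.2.2 rfl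
  obtain ⟨s, hs, h | h⟩ := exists_center (G := G) _ Y (fun x => ad G a x + ad G b x)
    (fun x => ad G c x + ad G d x) rfl hY0 hYa
    (fun K hK K' hK' hdis hK1 hK1' => hP (Pack.two
      (insert_subset ha (insert_subset hb (hK.trans hYS)))
      (insert_subset hc (insert_subset hd (hK'.trans hYS)))
      (hK1.dense_insert_insert (fun h => haY (hK h)) (fun h => hbY (hK h)) hab)
      (hK1'.dense_insert_insert (fun h => hcY (hK' h)) (fun h => hdY (hK' h)) hcd) (by
        have m1 : a ∉ K' := fun h => haY (hK' h)
        have m2 : b ∉ K' := fun h => hbY (hK' h)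
        have m3 : c ∉ K := fun h => hcY (hK h)
        have m4 : d ∉ K := fun h => hdY (hK h)
        simp [disjoint_insert_left, disjoint_insert_right, m1, m2, m3, m4, hdis, hac.symm, hbd.symm,
          hda.ne, hbc.ne'])))
  · exact key a b c d hc hd hcd h2 hdg s hs h
  · exact key c d a b ha hb hab h1 (fun x => by rw [hdg x]; omega) s hs h

lemma dg_eq_card_iff {S : Finset V} {v : V} : dg G S v = #S ↔ ∀ x ∈ S, G.Adj v x := by
  rw [dg_eq_card, card_filter_eq_iff]

lemma ed_swap {S C : Finset V} {u c : V} (hC : C ⊆ S) (hc : c ∈ C) (hu : u ∈ S \ C) :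
    ed G (S \ insert u (C.erase c)) + dg G (S \ C) u =
      dg G ((S \ C).erase u) c + ed G (S \ C) := by
  have h1 : S \ insert u (C.erase c) = insert c ((S \ C).erase u) := by
    ext x
    rw [mem_sdiff] at hu
    simp only [mem_sdiff, mem_insert, mem_erase]
    by_cases hxc : x = c
    · subst hxc
      have : x ≠ u := by rintro rfl; exact hu.2 hc
      simp [this, hC hc]
    · simp [hxc]; tauto
  have h2 : c ∉ (S \ C).erase u := by simp [hc]
  rw [h1, ed_insert h2, ← ed_erase (G := G) hu]
  omega

lemma exists_opt_dense {S D : Finset V} (hD : D ⊆ S) (hd : Dense G D) :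
    ∃ C ⊆ S, Dense G C ∧ (∀ K ⊆ S, Dense G K → #C ≤ #K) ∧
      ∀ K ⊆ S, Dense G K → #K = #C → ed G (S \ K) ≤ ed G (S \ C) := by
  obtain ⟨E, hE, hEd, hmin⟩ := exists_min_dense hD hd
  obtain ⟨C, hC, hmax⟩ := exists_max_image
    (S.powerset.filter fun K => Dense G K ∧ #K = #E) (fun K => ed G (S \ K)) ⟨E, by simp [hE, hEd]⟩
  simp only [mem_filter, mem_powerset] at hC hmax
  refine ⟨C, hC.1, hC.2.1, fun K h1 h2 => hC.2.2 ▸ hmin K h1 h2, fun K h1 h2 h3 => ?_⟩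
  exact hmax K ⟨h1, h2, h3.trans hC.2.2⟩

lemma pack_two_of_three_le {S : Finset V} (hdeg : ∀ x ∈ S, 3 ≤ dg G S x) (h13 : 13 ≤ #S)
    (hτ : 4 ≤ ∑ x ∈ S, tau (dg G S x)) : Pack G S 2 := by
  by_contra hP
  by_cases h5 : ∀ K ⊆ S, Dense G K → 5 ≤ #K
  · exact hP (pack_of_min_degree 2 S (card_pos.1 (by omega)) h5 hdeg)
  push Not at h5
  obtain ⟨D, hDS, hDd, hD4⟩ := h5
  obtain ⟨C, hCS, hCd, hmin, hmax⟩ := exists_opt_dense hDS hDd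
  have hC4 := hmin D hDS hDd
  have hC3 := three_le_card hCd
  have hm : ∀ x ∈ C, ¬ Dense G (C.erase x) := fun x hx h => by
    have := hmin _ ((erase_subset _ _).trans hCS) h
    rw [card_erase_of_mem hx] at this
    omega
  obtain ⟨hCe, hC2⟩ := dg_eq_two_of_min hCd hm
  obtain ⟨Y, hY⟩ : ∃ Y, S \ C = Y := ⟨_, rfl⟩
  have hYS : Y ⊆ S := hY ▸ sdiff_subset
  have hYc := card_sdiff_add_card_eq_card hCS
  rw [hY] at hYc
  have hY0 : Y.Nonempty := card_pos.1 (by omega)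
  have hYa : ∀ K ⊆ Y, ¬ Dense G K := fun K hK hd =>
    hP (Pack.two hCS (hK.trans hYS) hCd hd (disjoint_sdiff.mono_right (hY ▸ hK)))
  have hedY := ed_lt_of_not_dense (hYa Y Subset.rfl) hY0
  have hdg : ∀ x, dg G S x = dg G Y x + dg G C x := fun x => by rw [← dg_sdiff hCS, hY]
  obtain ⟨u, hu, hu1⟩ := exists_leaf (hYa Y Subset.rfl) hY0
  have huC : u ∉ C := fun h => by rw [← hY, mem_sdiff] at hu; exact hu.2 h
  have huCd : 2 ≤ dg G C u := by
    have := hdeg u (hYS hu); have := hdg u; omega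
  have hswap : ∀ c ∈ C, 2 ≤ dg G (C.erase c) u → dg G (Y.erase u) c ≤ 1 := by
    intro c hc h
    have hd := swap_dense hCd hm huC hc h
    have h1 : u ∉ C.erase c := fun h => huC (mem_of_mem_erase h)
    have h2 := hmax _ (insert_subset (hYS hu) ((erase_subset _ _).trans hCS)) hd (by
      rw [card_insert_of_notMem h1, card_erase_of_mem hc]; omega)
    have h3 := ed_swap (G := G) hCS hc (hY ▸ hu)
    rw [hY] at h2 h3
    omega
  rcases (by omega : #C = 3 ∨ #C = 4) with hC | hC
  · obtain ⟨c, hc, huc⟩ : ∃ c ∈ C, ¬ G.Adj u c := by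
      by_contra! hall
      have h1 : dg G C u = #C := dg_eq_card_iff.2 hall
      have h2 : ∑ c ∈ C, dg G Y c ≤ ∑ c ∈ C, 2 := by
        refine sum_le_sum fun c hc => ?_
        have h3 := dg_erase (G := G) hc u
        rw [ad_of_adj (hall c hc)] at h3
        have h4 := hswap c hc (by omega)
        have h5 := dg_erase (G := G) hu c
        have := ad_le_one (G := G) c u
        omega
      rw [sum_dg_comm, sum_const, smul_eq_mul] at h2
      have h3 : ∑ x ∈ Y, 3 ≤ ∑ x ∈ Y, dg G S x := sum_le_sum fun x hx => hdeg x (hYS hx)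
      simp only [hdg, sum_add_distrib, sum_const, smul_eq_mul] at h3
      have h4 := two_mul_ed (G := G) Y
      omega
    have e1 := dg_erase (G := G) hc u
    rw [ad_of_not_adj huc] at e1
    have e2 : #(C.erase c) = 2 := by rw [card_erase_of_mem hc]; omega
    obtain ⟨a, b, hab, hCab⟩ := card_eq_two.1 e2
    have hCabc : C = {a, b, c} := by
      rw [← insert_erase hc, hCab]; ext x; simp; tauto
    have ha : a ∈ C := by simp [hCabc]
    have hb : b ∈ C := by simp [hCabc]
    have hadj : ∀ x ∈ C, ∀ y ∈ C, x ≠ y → G.Adj x y := by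
      intro x hx y hy hxy
      have h1 := hC2 x hx
      rw [← dg_erase_self] at h1
      have h2 : dg G (C.erase x) x = #(C.erase x) := by
        rw [h1, card_erase_of_mem hx]; omega
      exact dg_eq_card_iff.1 h2 y (mem_erase.2 ⟨hxy.symm, hy⟩)
    have hac : a ≠ c := by
      rintro rfl; exact notMem_erase a C (by simp [hCab])
    have hbc : b ≠ c := by
      rintro rfl; exact notMem_erase b C (by simp [hCab])
    refine hP (pack_two_triangle (hCS ha) (hCS hb) (hCS hc) (hadj a ha b hb hab)
      (hadj b hb c hc hbc) (hadj a ha c hc hac) ?_ (by omega)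
      (fun x hx => (by omega : 2 ≤ 3).trans (hdeg x hx)) hτ)
    rw [← hCabc, hY, ← dg_erase hu c, ad_comm, ad_of_not_adj huc]
    have := hswap c hc (by omega)
    omega
  · have htri : ∀ x ∈ S, ∀ y ∈ S, ∀ z ∈ S, G.Adj x y → G.Adj y z → ¬ G.Adj x z := by
      intro x hx y hy z hz e1 e2 e3
      have := hmin {x, y, z} (by simp [insert_subset_iff, hx, hy, hz]) (dense_triple e1 e2 e3)
      have := card_le_three (a := x) (b := y) (c := z)
      omega
    have h1 := huCd
    rw [dg_eq_card] at h1
    obtain ⟨a, ha, c, hc, hac⟩ := one_lt_card.1 h1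
    rw [mem_filter] at ha hc
    have hca : c ∈ C.erase a := mem_erase.2 ⟨hac.symm, hc.1⟩
    have e2 : #((C.erase a).erase c) = 2 := by
      rw [card_erase_of_mem hca, card_erase_of_mem ha.1]; omega
    obtain ⟨b, d, hbd, hCbd⟩ := card_eq_two.1 e2
    have hb : b ∈ (C.erase a).erase c := by simp [hCbd]
    have hd : d ∈ (C.erase a).erase c := by simp [hCbd]
    have hCabcd : C = {a, b, c, d} := by
      rw [← insert_erase ha.1, ← insert_erase hca, hCbd]; ext x; simp; tauto
    have hac' : ¬ G.Adj a c := fun h => htri u (hYS hu) a (hCS ha.1) c (hCS hc.1) ha.2 h hc.2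
    have hadj : ∀ y ∈ (C.erase a).erase c, G.Adj a y ∧ G.Adj c y := by
      have g1 := hC2 a ha.1
      have g2 := hC2 c hc.1
      rw [← dg_erase ha.1] at g1 g2
      rw [← dg_erase hca] at g1 g2
      rw [ad_self, ad_of_not_adj hac'] at g1
      rw [ad_self, ad_comm, ad_of_not_adj hac'] at g2
      exact fun y hy => ⟨dg_eq_card_iff.1 (by omega) y hy, dg_eq_card_iff.1 (by omega) y hy⟩
    have hlow : ∀ y ∈ (C.erase a).erase c, dg G Y y ≤ 1 := by
      intro y hy
      have hyC := mem_of_mem_erase (mem_of_mem_erase hy)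
      have huy : ¬ G.Adj u y :=
        htri u (hYS hu) a (hCS ha.1) y (hCS hyC) ha.2 (hadj y hy).1
      have g1 := dg_erase (G := G) hyC u
      rw [ad_of_not_adj huy] at g1
      have g2 := hswap y hyC (by omega)
      have g3 := dg_erase (G := G) hu y
      rw [ad_comm, ad_of_not_adj huy] at g3
      omega
    have hbS := hCS (mem_of_mem_erase (mem_of_mem_erase hb))
    have hdS := hCS (mem_of_mem_erase (mem_of_mem_erase hd))
    refine hP (pack_two_square (hCS ha.1) hbS (hCS hc.1) hdS (hadj b hb).1 (hadj b hb).2.symm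
      (hadj d hd).2 (hadj d hd).1.symm hac hbd (fun K hK hd => hC ▸ hmin K hK hd) ?_ ?_ (by omega)
      (fun x hx => (by omega : 2 ≤ 3).trans (hdeg x hx)) hτ)
    · rw [← hCabcd, hY]; exact hlow b hb
    · rw [← hCabcd, hY]; exact hlow d hd

lemma pack_two_of_deg_two_triangle {S : Finset V} {v y z : V} (hv : v ∈ S) (hy : y ∈ S)
    (hz : z ∈ S) (hvy : G.Adj v y) (hyz : G.Adj y z) (hvz : G.Adj v z) (hv2 : dg G S v = 2)
    (hdeg : ∀ x ∈ S, 2 ≤ dg G S x) (h4 : 4 ≤ #S) (hτ : 4 ≤ ∑ x ∈ S, tau (dg G S x)) :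
    Pack G S 2 := by
  by_contra hP
  have hCS : ({v, y, z} : Finset V) ⊆ S := by simp [insert_subset_iff, hv, hy, hz]
  have hCd : Dense G {v, y, z} := dense_triple hvy hyz hvz
  have n1 : v ∉ ({y, z} : Finset V) := by simp [hvy.ne, hvz.ne]
  have n2 : y ∉ ({z} : Finset V) := by simp [hyz.ne]
  have hCc : #({v, y, z} : Finset V) = 3 := by
    rw [card_insert_of_notMem n1, card_insert_of_notMem n2, card_singleton]
  obtain ⟨Y, hY⟩ : ∃ Y, S \ {v, y, z} = Y := ⟨_, rfl⟩
  have hYS : Y ⊆ S := hY ▸ sdiff_subset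
  have hYc := card_sdiff_add_card_eq_card hCS
  rw [hY] at hYc
  have hY0 : Y.Nonempty := card_pos.1 (by omega)
  have hYa : ∀ K ⊆ Y, ¬ Dense G K := fun K hK hd =>
    hP (Pack.two hCS (hK.trans hYS) hCd hd (disjoint_sdiff.mono_right (hY ▸ hK)))
  have hYn : ∀ x ∈ Y, x ≠ v ∧ x ≠ y ∧ x ≠ z := fun x hx => by
    rw [← hY, mem_sdiff] at hx; simpa using hx.2
  have hdg : ∀ x, dg G S x = dg G Y x + (ad G x v + ad G x y + ad G x z) := fun x => by
    rw [← dg_sdiff hCS, hY, dg_insert n1, dg_insert n2, dg_singleton]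
    omega
  have hedY := ed_lt_of_not_dense (hYa Y Subset.rfl) hY0
  have hvY : dg G Y v = 0 := by
    have := hdg v
    rw [ad_of_adj hvy, ad_of_adj hvz] at this
    omega
  have key : ∀ y z : V, (∀ x, dg G S x = dg G Y x + (ad G x v + ad G x y + ad G x z)) →
      ∀ s ∈ Y, ¬ ∀ K ⊆ Y.erase s, ¬ CDense G (ad G y) K := by
    intro a b hdg s hs hcon
    have e1 := hcon (Y.erase s) Subset.rfl
    unfold CDense at e1
    change ¬ _ ≤ _ + dg G (Y.erase s) a at e1
    have e2 : ∑ x ∈ Y.erase s, (dg G S x : ℤ) = (ed G (Y.erase s) + ed G Y +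
        (dg G (Y.erase s) v + dg G (Y.erase s) a + dg G (Y.erase s) b) : ℕ) := by
      rw [← Nat.cast_sum]
      simp only [hdg, sum_add_distrib, sum_ad, sum_dg_erase hs]
    have e3 := dg_le_card (G := G) (Y.erase s) b
    have e4 := dg_mono (G := G) (erase_subset s Y) v
    have e5 := sum_tau_le fun x hx => hdeg x (hYS (mem_of_mem_erase (a := s) hx))
    have e6 := add_sum_erase Y (fun x => tau (dg G S x)) hs
    have e7 := tau_le_one (dg G S s)
    have e8 : #(Y.erase s) = #Y - 1 := card_erase_of_mem hs
    have h := sum_sdiff (f := fun x => tau (dg G S x)) hCS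
    rw [sum_insert n1, sum_insert n2, sum_singleton, hY, hv2] at h
    have t1 := tau_le_one (dg G S y)
    have t2 := tau_le_one (dg G S z)
    have t3 : tau 2 = -1 := rfl
    omega
  have hyY : y ∉ Y := fun h => (hYn y h).2.1 rfl
  have hzY : z ∉ Y := fun h => (hYn z h).2.2 rfl
  obtain ⟨s, hs, h | h⟩ := exists_center (G := G) _ Y (ad G y) (ad G z) rfl hY0 hYa
    (fun K hK K' hK' hd hc hc' => hP (Pack.two (insert_subset hy (hK.trans hYS))
      (insert_subset hz (hK'.trans hYS)) (hc.dense_insert fun h => hyY (hK h))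
      (hc'.dense_insert fun h => hzY (hK' h)) (by
        have h1 : y ∉ K' := fun h => hyY (hK' h)
        have h2 : z ∉ K := fun h => hzY (hK h)
        simp [disjoint_insert_left, disjoint_insert_right, h1, h2, hyz.ne', hd])))
  · exact key y z hdg s hs h
  · exact key z y (fun x => by rw [hdg x]; omega) s hs h

lemma alp_le (d : ℕ) : alp d ≤ 4 := by unfold alp; split_ifs <;> omega

lemma pack_two (n : ℕ) : ∀ (G : SimpleGraph V) (S : Finset V), #S ≤ n →
    4 ≤ ∑ x ∈ S, tau (dg G S x) → 50 ≤ ∑ x ∈ S, alp (dg G S x) → Pack G S 2 := by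
  induction n with
  | zero =>
    intro G S hn h1 _
    rw [Nat.le_zero, card_eq_zero] at hn
    subst hn
    simp at h1
  | succ n ih =>
    intro G S hn hτ hα
    have h13 : 13 ≤ #S := by
      have : ∑ x ∈ S, alp (dg G S x) ≤ ∑ x ∈ S, 4 := sum_le_sum fun x _ => alp_le _
      rw [sum_const, nsmul_eq_mul] at this
      omega
    by_cases h1 : ∃ v ∈ S, dg G S v ≤ 1
    · obtain ⟨v, hv, hv1⟩ := h1
      have hcard : #(S.erase v) ≤ n := by rw [card_erase_of_mem hv]; omega
      have hd : ∀ x ∈ S.erase v, dg G S x = dg G (S.erase v) x + ad G v x := fun x _ => by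
        rw [← dg_erase hv, ad_comm]; omega
      have hsum : ∑ x ∈ S.erase v, (ad G v x : ℤ) = dg G S v := by
        rw [← dg_erase_self, dg]; push_cast; rfl
      refine (ih G (S.erase v) hcard ?_ ?_).mono (erase_subset _ _)
      · have g1 := add_sum_erase S (fun x => tau (dg G S x)) hv
        have g2 : tau (dg G S v) = -1 := by unfold tau; split_ifs <;> omega
        have g3 : ∑ x ∈ S.erase v, tau (dg G S x) ≤
            ∑ x ∈ S.erase v, (tau (dg G (S.erase v) x) + ad G v x) := by
          refine sum_le_sum fun x hx => ?_
          have := hd x hx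
          have := ad_le_one (G := G) v x
          unfold tau; split_ifs <;> omega
        rw [sum_add_distrib, hsum] at g3
        omega
      · have g1 := add_sum_erase S (fun x => alp (dg G S x)) hv
        have g2 : alp (dg G S v) = -2 := by unfold alp; split_ifs <;> omega
        have g3 : ∑ x ∈ S.erase v, alp (dg G S x) ≤
            ∑ x ∈ S.erase v, (alp (dg G (S.erase v) x) + 2 * ad G v x) := by
          refine sum_le_sum fun x hx => ?_
          have := hd x hx
          have := ad_le_one (G := G) v x
          unfold alp; split_ifs <;> omega
        rw [sum_add_distrib, ← mul_sum, hsum] at g3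
        omega
    push Not at h1
    by_cases h2 : ∃ v ∈ S, dg G S v = 2
    · obtain ⟨v, hv, hv2⟩ := h2
      obtain ⟨y, z, hyz, hN⟩ := card_eq_two.1 ((dg_eq_card S v).symm.trans hv2)
      have hy : y ∈ S ∧ G.Adj v y := mem_filter.1 (hN ▸ by simp)
      have hz : z ∈ S ∧ G.Adj v z := mem_filter.1 (hN ▸ by simp)
      by_cases hadj : G.Adj y z
      · exact pack_two_of_deg_two_triangle hv hy.1 hz.1 hy.2 hadj hz.2 hv2 h1 (by omega) hτ
      have hc : ∀ x ∈ S, G.Adj v x → ¬ G.Adj y x := fun x hx hvx hyx => by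
        have : x ∈ S.filter (G.Adj v) := mem_filter.2 ⟨hx, hvx⟩
        rw [hN, mem_insert, mem_singleton] at this
        rcases this with rfl | rfl
        · exact G.irrefl hyx
        · exact hadj hyx
      have hcard : #(S.erase v) ≤ n := by rw [card_erase_of_mem hv]; omega
      have hd : ∀ x ∈ S.erase v, dg (ctr G v y) (S.erase v) x = dg G S x := by
        intro x hx
        by_cases hxy : x = y
        · subst hxy
          have := dg_ctr_erase_self hv hy.1 hy.2 hc
          omega
        · exact dg_ctr_erase_of_ne hv hy.1 hy.2 hc (mem_of_mem_erase hx) hxy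
      have := Pack.of_ctr hy.2 (notMem_erase v S) (fun x hx => hc x (mem_of_mem_erase hx))
        (ih (ctr G v y) (S.erase v) hcard ?_ ?_)
      · rwa [insert_erase hv] at this
      · rw [sum_congr rfl fun x hx => by rw [hd x hx]]
        have g1 := add_sum_erase S (fun x => tau (dg G S x)) hv
        have : tau 2 = -1 := rfl
        rw [hv2] at g1
        omega
      · rw [sum_congr rfl fun x hx => by rw [hd x hx]]
        have g1 := add_sum_erase S (fun x => alp (dg G S x)) hv
        have : alp 2 = 0 := rfl
        rw [hv2] at g1
        omega
    · push Not at h2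
      exact pack_two_of_three_le (fun x hx => by
        have := h1 x hx; have := h2 x hx; omega) h13 hτ

/-- The contribution of a vertex of degree `d` to `|H_k| - |L_k|`. -/
def hl (k d : ℕ) : ℤ := if 2 * k ≤ d then 1 else if d ≤ 2 * k - 2 then -1 else 0

lemma hl_le_one (k d : ℕ) : hl k d ≤ 1 := by unfold hl; split_ifs <;> omega

/-- The degree condition forcing `k` disjoint cycles. -/
def Surplus (G : SimpleGraph V) (S : Finset V) (k : ℕ) : Prop :=
  2 * (k : ℤ) ≤ ∑ x ∈ S, hl k (dg G S x) ∧ 25 * (k : ℤ) ≤ #S + 3 * ∑ x ∈ S, hl k (dg G S x)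

lemma CDense.mono {ν μ : V → ℕ} {K : Finset V} (h : CDense G ν K) (hνμ : ∀ x ∈ K, ν x ≤ μ x) :
    CDense G μ K := by
  have := sum_le_sum hνμ
  unfold CDense at *
  omega

lemma sum_indicator (N K : Finset V) : ∑ x ∈ K, (if x ∈ N then 1 else 0) = #(K ∩ N) := by
  rw [← card_filter, filter_mem_eq_inter]

lemma surplus_sdiff_pair {S : Finset V} {k : ℕ} {a b : V} (hk : 1 ≤ k) (ha : a ∈ S)
    (hb : b ∈ S) (hab : a ≠ b) (h : Surplus G S (k + 1)) : Surplus G (S \ {a, b}) k := by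
  have hsub : ({a, b} : Finset V) ⊆ S := by simp [insert_subset_iff, ha, hb]
  have hn : a ∉ ({b} : Finset V) := by simpa using hab
  have h1 := sum_sdiff (f := fun x => hl (k + 1) (dg G S x)) hsub
  rw [sum_insert hn, sum_singleton] at h1
  have h2 := hl_le_one (k + 1) (dg G S a)
  have h3 := hl_le_one (k + 1) (dg G S b)
  have h4 := card_sdiff_add_card_eq_card hsub
  rw [card_insert_of_notMem hn, card_singleton] at h4
  have h5 : ∑ x ∈ S \ {a, b}, hl (k + 1) (dg G S x) ≤
      ∑ x ∈ S \ {a, b}, hl k (dg G (S \ {a, b}) x) := by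
    refine sum_le_sum fun x _ => ?_
    have e1 := dg_sdiff (G := G) hsub x
    rw [dg_insert hn, dg_singleton] at e1
    have e2 := ad_le_one (G := G) x a
    have e3 := ad_le_one (G := G) x b
    unfold hl
    split_ifs <;> omega
  obtain ⟨h6, h7⟩ := h
  push_cast at h6 h7
  constructor <;> omega

/-- Two vertices with many common neighbours allow one more cycle. -/
lemma pack_of_hub {S : Finset V} {k : ℕ} {a b : V} (hk : 1 ≤ k) (ha : a ∈ S) (hb : b ∈ S)
    (hab : a ≠ b) (hS : Surplus G S (k + 1)) (ih : ∀ T, Surplus G T k → Pack G T k)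
    {N : Finset V} (hNS : N ⊆ S) (hN : ∀ x ∈ N, G.Adj a x ∧ G.Adj b x)
    (hcard : 4 * k + 2 ≤ #N) : Pack G S (k + 1) := by
  obtain ⟨F, rfl, hF, hdisj⟩ := (ih _ (surplus_sdiff_pair hk ha hb hab hS)).exists_family
  have hFS : ∀ C ∈ F, C ⊆ S ∧ Dense G C := fun C hC =>
    ⟨(hF C hC).1.trans sdiff_subset, (hF C hC).2.1⟩
  have haC : ∀ C ∈ F, a ∉ C := fun C hC h => by
    have := (hF C hC).1 h
    simp at this
  have hbC : ∀ C ∈ F, b ∉ C := fun C hC h => by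
    have := (hF C hC).1 h
    simp at this
  by_cases h2 : 2 ≤ #(N \ F.biUnion id)
  · obtain ⟨x, hx, y, hy, hxy⟩ := one_lt_card.1 h2
    rw [mem_sdiff] at hx hy
    refine Pack.of_family hFS hdisj (Pack.cons (K := {a, x, b, y}) ?_ (dense_quad
      (hN x hx.1).1 (hN x hx.1).2.symm (hN y hy.1).2 (hN y hy.1).1.symm hab hxy) trivial)
    have h3 : a ∉ F.biUnion id := fun h => by
      obtain ⟨C, hC, h⟩ := mem_biUnion.1 h
      exact haC C hC h
    have h4 : b ∉ F.biUnion id := fun h => by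
      obtain ⟨C, hC, h⟩ := mem_biUnion.1 h
      exact hbC C hC h
    simp only [insert_subset_iff, singleton_subset_iff, mem_sdiff]
    exact ⟨⟨ha, h3⟩, ⟨hNS hx.1, hx.2⟩, ⟨hb, h4⟩, ⟨hNS hy.1, hy.2⟩⟩
  have h3 : 4 * #F < #(F.biUnion fun C => C ∩ N) := by
    have h4 : #(N ∩ F.biUnion id) + #(N \ F.biUnion id) = #N := card_inter_add_card_sdiff _ _
    have h5 : (F.biUnion fun C => C ∩ N) = N ∩ F.biUnion id := by
      ext x; simp; tauto
    rw [h5]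
    omega
  obtain ⟨D, hD, hD5⟩ : ∃ D ∈ F, 5 ≤ #(D ∩ N) := by
    by_contra! hcon
    have := card_biUnion_le_card_mul F (fun C => C ∩ N) 4 fun C hC => by
      have := hcon C hC; omega
    omega
  obtain ⟨hDS, hDd, hDm⟩ := hF D hD
  obtain ⟨hDe, hD2⟩ := dg_eq_two_of_min hDd fun x hx => not_dense_erase hDm hx
  obtain ⟨r, hr⟩ := hDd.1
  have h3c := three_le_card hDd
  have hYc : #(D.erase r) = #D - 1 := card_erase_of_mem hr
  have hYe := ed_erase (G := G) hr
  rw [hD2 r hr] at hYe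
  by_contra hP
  obtain ⟨s, hs, h⟩ := exists_center (G := G) _ (D.erase r) (fun x => if x ∈ N then 1 else 0)
    (fun x => if x ∈ N then 1 else 0) rfl (card_pos.1 (by omega)) (fun K hK hd => by
      have := hDm K (hK.trans (erase_subset _ _)) hd
      have := card_le_card hK
      omega) (by
    intro K hK K' hK' hKK h h'
    have hKD := hK.trans (erase_subset _ _)
    have hKD' := hK'.trans (erase_subset _ _)
    refine hP ?_
    have hcard : #F + 1 = #(F.erase D) + 2 := by
      rw [card_erase_of_mem hD]
      have := card_pos.2 ⟨D, hD⟩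
      omega
    rw [hcard]
    have hsub : ∀ v ∈ S, (∀ C ∈ F, v ∉ C) → ∀ L ⊆ D,
        insert v L ⊆ S \ (F.erase D).biUnion id := by
      intro v hv hvC L hL
      refine insert_subset ?_ fun x hx => ?_
      · rw [mem_sdiff, mem_biUnion]
        exact ⟨hv, fun ⟨C, hC, h⟩ => hvC C (mem_of_mem_erase hC) h⟩
      · rw [mem_sdiff, mem_biUnion]
        refine ⟨(hFS D hD).1 (hL hx), fun ⟨C, hC, h⟩ => ?_⟩
        rw [mem_erase] at hC
        exact disjoint_left.1 (hdisj hC.2 hD hC.1) h (hL hx)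
    have haK : ∀ L ⊆ D, a ∉ L := fun L hL h => haC D hD (hL h)
    have hbK : ∀ L ⊆ D, b ∉ L := fun L hL h => hbC D hD (hL h)
    refine Pack.of_family (fun C hC => hFS C (mem_of_mem_erase hC))
      (hdisj.subset (by simp)) (Pack.two (hsub a ha haC K hKD) (hsub b hb hbC K' hKD') ?_ ?_ ?_)
    · refine CDense.dense_insert (haK K hKD) (h.mono fun x _ => ?_)
      split_ifs with hx
      · rw [ad_of_adj (hN x hx).1]
      · exact Nat.zero_le _
    · refine CDense.dense_insert (hbK K' hKD') (h'.mono fun x _ => ?_)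
      split_ifs with hx
      · rw [ad_of_adj (hN x hx).2]
      · exact Nat.zero_le _
    · simp [disjoint_insert_left, disjoint_insert_right, haK K' hKD', hbK K hKD, hab.symm, hKK])
  rw [or_self] at h
  have e1 := h _ Subset.rfl
  unfold CDense at e1
  rw [sum_indicator] at e1
  have e2 := ed_erase (G := G) hs
  have e3 := dg_mono (G := G) (erase_subset r D) s
  rw [hD2 s (mem_of_mem_erase hs)] at e3
  have e4 : #((D.erase r).erase s) = #(D.erase r) - 1 := card_erase_of_mem hs
  have e5 : #(D ∩ N) ≤ #(((D.erase r).erase s) ∩ N) + 2 := by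
    have h6 : D ∩ N ⊆ insert r (insert s (((D.erase r).erase s) ∩ N)) := by
      intro x; simp; tauto
    have := card_le_card h6
    have := card_insert_le r (insert s (((D.erase r).erase s) ∩ N))
    have := card_insert_le s (((D.erase r).erase s) ∩ N)
    omega
  omega

lemma exists_lex_max {ι : Type*} {s : Finset ι} (hs : s.Nonempty) (f g h : ι → ℕ) :
    ∃ x ∈ s, ∀ y ∈ s, f y ≤ f x ∧ (f y = f x → g y ≤ g x ∧ (g y = g x → h y ≤ h x)) := by
  obtain ⟨x, hx, h1⟩ := exists_max_image s f hs
  obtain ⟨y, hy, h2⟩ := exists_max_image (s.filter fun y => f y = f x) g ⟨x, by simp [hx]⟩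
  obtain ⟨z, hz, h3⟩ := exists_max_image (s.filter fun z => f z = f x ∧ g z = g y) h
    ⟨y, by simpa using hy⟩
  simp only [mem_filter] at hy h2 hz h3
  refine ⟨z, hz.1, fun a ha => ⟨hz.2.1 ▸ h1 a ha, fun e => ⟨hz.2.2 ▸ h2 a ⟨ha, e.trans hz.2.1⟩,
    fun e' => h3 a ⟨ha, e.trans hz.2.1, e'.trans hz.2.2⟩⟩⟩⟩

/-- Pairwise disjoint triangles and quadrilaterals in `S`. -/
structure ShortFamily (G : SimpleGraph V) (S : Finset V) (F : Finset (Finset V)) : Prop where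
  mem : ∀ C ∈ F, C ⊆ S ∧ Dense G C
  card_le : ∀ C ∈ F, #C ≤ 4
  disj : (F : Set (Finset V)).PairwiseDisjoint id

namespace ShortFamily

variable {S : Finset V} {F : Finset (Finset V)} {C D : Finset V}

lemma erase (h : ShortFamily G S F) (C : Finset V) : ShortFamily G S (F.erase C) where
  mem D hD := h.mem D (mem_of_mem_erase hD)
  card_le D hD := h.card_le D (mem_of_mem_erase hD)
  disj := h.disj.subset (by simp)

lemma insert (h : ShortFamily G S F) (hD : D ⊆ S \ F.biUnion id) (hd : Dense G D)
    (hc : #D ≤ 4) : ShortFamily G S (insert D F) ∧ #(insert D F) = #F + 1 ∧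
      S \ (insert D F).biUnion id = (S \ F.biUnion id) \ D := by
  have h1 : ∀ C ∈ F, Disjoint D C := fun C hC =>
    disjoint_of_subset_left hD (disjoint_of_subset_right (subset_biUnion_of_mem id hC)
      sdiff_disjoint)
  have h2 : D ∉ F := fun h => by
    have := h1 D h
    rw [disjoint_self_iff_empty] at this
    exact hd.1.ne_empty this
  refine ⟨⟨?_, ?_, ?_⟩, card_insert_of_notMem h2, ?_⟩
  · simp only [mem_insert, forall_eq_or_imp]
    exact ⟨⟨hD.trans sdiff_subset, hd⟩, h.mem⟩
  · simp only [mem_insert, forall_eq_or_imp]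
    exact ⟨hc, h.card_le⟩
  · rw [coe_insert, Set.pairwiseDisjoint_insert]
    exact ⟨h.disj, fun C hC _ => h1 C hC⟩
  · rw [biUnion_insert]
    ext x
    simp
    tauto

lemma sdiff_erase (h : ShortFamily G S F) (hC : C ∈ F) :
    S \ (F.erase C).biUnion id = C ∪ S \ F.biUnion id := by
  ext x
  simp only [mem_sdiff, mem_biUnion, mem_erase, id, mem_union, not_exists, not_and]
  constructor
  · rintro ⟨h1, h2⟩
    by_cases hx : x ∈ C
    · exact Or.inl hx
    · exact Or.inr ⟨h1, fun D hD hxD => h2 D ⟨fun e => hx (e ▸ hxD), hD⟩ hxD⟩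
  · rintro (h1 | ⟨h1, h2⟩)
    · exact ⟨(h.mem C hC).1 h1, fun D hD hxD =>
        disjoint_left.1 (h.disj hD.2 hC hD.1) hxD h1⟩
    · exact ⟨h1, fun D hD => h2 D hD.2⟩

end ShortFamily

/-- A family of short cycles of maximum size, of minimum total length, and leaving the maximum
number of edges in the remainder `Y`. -/
structure OptFamily (G : SimpleGraph V) (S : Finset V) (F : Finset (Finset V))
    (Y : Finset V) : Prop extends ShortFamily G S F where
  sdiff_eq : S \ F.biUnion id = Y
  rest : ∀ K ⊆ Y, Dense G K → 5 ≤ #K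
  le_card : ∀ C ∈ F, ∀ D ⊆ C ∪ Y, Dense G D → #C ≤ #D
  swap : ∀ C ∈ F, ∀ c ∈ C, ∀ v ∈ Y, Dense G (insert v (C.erase c)) →
    dg G (Y.erase v) c ≤ dg G Y v

lemma exists_optFamily (G : SimpleGraph V) (S : Finset V) : ∃ F Y, OptFamily G S F Y := by
  obtain ⟨F, hF, hmax⟩ := exists_lex_max (s := S.powerset.powerset.filter (ShortFamily G S))
    ⟨∅, by simp only [mem_filter, empty_mem_powerset, true_and]; exact ⟨by simp, by simp, by simp⟩⟩
    card (fun F => #(S \ F.biUnion id)) (fun F => ed G (S \ F.biUnion id))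
  have hsf : ∀ F, F ∈ S.powerset.powerset.filter (ShortFamily G S) ↔ ShortFamily G S F := by
    intro F
    simp only [mem_filter, mem_powerset, and_iff_right_iff_imp]
    exact fun h C hC => mem_powerset.2 (h.mem C hC).1
  simp only [hsf] at hF hmax
  have hY : ∀ C ∈ F, Disjoint C (S \ F.biUnion id) := fun C hC =>
    disjoint_of_subset_left (subset_biUnion_of_mem id hC) disjoint_sdiff
  have hrep : ∀ C ∈ F, ∀ D ⊆ C ∪ S \ F.biUnion id, Dense G D → #D ≤ #C →
      #D = #C ∧ ed G ((C ∪ S \ F.biUnion id) \ D) ≤ ed G (S \ F.biUnion id) := by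
    intro C hC D hD hd hc
    have e0 := hF.sdiff_erase hC
    rw [← e0] at hD
    obtain ⟨h1, h2, h3⟩ := (hF.erase C).insert hD hd (hc.trans (hF.card_le C hC))
    have h4 := (hmax _ h1).2 (by
      rw [h2, card_erase_of_mem hC]
      have := card_pos.2 ⟨C, hC⟩
      omega)
    rw [h3] at h4
    have h5 := card_sdiff_add_card_eq_card hD
    rw [e0] at h4 h5
    rw [card_union_of_disjoint (hY C hC)] at h5
    have h6 := h4.1
    exact ⟨by omega, h4.2 (by omega)⟩
  refine ⟨F, _, hF, rfl, ?_, ?_, ?_⟩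
  · intro K hK hd
    by_contra! hc
    obtain ⟨h1, h2, -⟩ := hF.insert hK hd (by omega)
    have := (hmax _ h1).1
    omega
  · intro C hC D hD hd
    by_contra! hc
    have := (hrep C hC D hD hd hc.le).1
    omega
  · intro C hC c hc v hv hd
    have hvC : v ∉ C := fun h => disjoint_left.1 (hY C hC) h hv
    have hcY : c ∉ S \ F.biUnion id := disjoint_left.1 (hY C hC) hc
    have h1 := (hrep C hC _ (insert_subset (mem_union_right _ hv)
      ((erase_subset _ _).trans subset_union_left)) hd (by
        rw [card_insert_of_notMem (fun h => hvC (mem_of_mem_erase h)), card_erase_of_mem hc]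
        have := card_pos.2 ⟨c, hc⟩
        omega)).2
    have h2 : (C ∪ S \ F.biUnion id) \ insert v (C.erase c) =
        insert c ((S \ F.biUnion id).erase v) := by
      ext x
      by_cases hxc : x = c
      · subst hxc
        simp [hc]
        rintro rfl
        exact hvC hc
      · by_cases hxC : x ∈ C
        · have := disjoint_left.1 (hY C hC) hxC
          simp only [mem_sdiff] at this
          simp [hxC, hxc]
          tauto
        · simp [hxC, hxc]
          tauto
    rw [h2, ed_insert (fun h => hcY (mem_of_mem_erase h))] at h1
    have h3 := ed_erase (G := G) hv
    omega

lemma dg_biUnion {F : Finset (Finset V)} (h : (F : Set (Finset V)).PairwiseDisjoint id) (v : V) :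
    dg G (F.biUnion id) v = ∑ C ∈ F, dg G C v := by
  unfold dg
  rw [sum_biUnion h]
  rfl

namespace OptFamily

variable {S Y C : Finset V} {F : Finset (Finset V)} {v : V}

lemma disjoint (h : OptFamily G S F Y) (hC : C ∈ F) : Disjoint C Y := by
  rw [← h.sdiff_eq]
  exact disjoint_of_subset_left (subset_biUnion_of_mem id hC) disjoint_sdiff

lemma rest_subset (h : OptFamily G S F Y) : Y ⊆ S := h.sdiff_eq ▸ sdiff_subset

lemma biUnion_id_subset (h : OptFamily G S F Y) : F.biUnion id ⊆ S :=
  biUnion_subset.2 fun C hC => (h.mem C hC).1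

lemma notMem (h : OptFamily G S F Y) (hC : C ∈ F) (hv : v ∈ Y) : v ∉ C :=
  fun hvC => disjoint_left.1 (h.disjoint hC) hvC hv

lemma not_dense_erase (h : OptFamily G S F Y) (hC : C ∈ F) :
    ∀ x ∈ C, ¬ Dense G (C.erase x) := fun _ hx =>
  DisjointCycles.not_dense_erase (fun K hK => h.le_card C hC K (hK.trans subset_union_left)) hx

lemma dg_self (h : OptFamily G S F Y) (hC : C ∈ F) {x : V} (hx : x ∈ C) : dg G C x = 2 :=
  (dg_eq_two_of_min (h.mem C hC).2 (h.not_dense_erase hC)).2 x hx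

lemma dg_eq_add (h : OptFamily G S F Y) (v : V) :
    dg G S v = dg G Y v + ∑ C ∈ F, dg G C v := by
  rw [← dg_sdiff h.biUnion_id_subset, h.sdiff_eq, dg_biUnion h.disj]

lemma not_triangle (h : OptFamily G S F Y) (hC : C ∈ F) (h4 : #C = 4) {x y z : V}
    (hx : x ∈ C ∪ Y) (hy : y ∈ C ∪ Y) (hz : z ∈ C ∪ Y) (hxy : G.Adj x y) (hyz : G.Adj y z)
    (hxz : G.Adj x z) : False := by
  have h1 := h.le_card C hC {x, y, z} (insert_subset hx (insert_subset hy
    (singleton_subset_iff.2 hz))) (dense_triple hxy hyz hxz)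
  have := card_le_three (a := x) (b := y) (c := z)
  omega

lemma dg_le_two (h : OptFamily G S F Y) (hC : C ∈ F) (hv : v ∈ Y) (h4 : #C = 4) :
    dg G C v ≤ 2 := by
  by_contra! hc
  rw [dg_eq_card] at hc
  obtain ⟨p, hp⟩ := card_pos.1 (by omega : 0 < #(C.filter (G.Adj v)))
  have h1 := dg_sdiff (G := G) (filter_subset (G.Adj v) C) p
  have h2 := card_sdiff_add_card_eq_card (filter_subset (G.Adj v) C)
  have h3 := dg_le_card (G := G) (C \ C.filter (G.Adj v)) p
  rw [h.dg_self hC (mem_filter.1 hp).1] at h1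
  obtain ⟨q, hq, hpq⟩ := exists_adj_of_dg_pos (G := G) (S := C.filter (G.Adj v)) (v := p)
    (by omega)
  rw [mem_filter] at hp hq
  exact h.not_triangle hC h4 (mem_union_right _ hv) (mem_union_left _ hp.1)
    (mem_union_left _ hq.1) hp.2 hpq hq.2

lemma card_eq (h : OptFamily G S F Y) (hC : C ∈ F) : #C = 3 ∨ #C = 4 := by
  have := three_le_card (h.mem C hC).2
  have := h.card_le C hC
  omega

lemma dg_le_three (h : OptFamily G S F Y) (hC : C ∈ F) (hv : v ∈ Y) : dg G C v ≤ 3 := by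
  rcases h.card_eq hC with h3 | h4
  · rw [← h3]; exact dg_le_card _ _
  · exact (h.dg_le_two hC hv h4).trans (by norm_num)

lemma dg_swap_le (h : OptFamily G S F Y) (hC : C ∈ F) {c : V} (hc : c ∈ C) (hv : v ∈ Y)
    (h2 : 2 ≤ dg G (C.erase c) v) : dg G Y c ≤ dg G Y v + ad G c v := by
  have h1 := h.swap C hC c hc v hv (swap_dense (h.mem C hC).2 (h.not_dense_erase hC)
    (h.notMem hC hv) hc h2)
  have := dg_erase (G := G) hv c
  omega

lemma dg_le_of_dg_eq_three (h : OptFamily G S F Y) (hC : C ∈ F) (hv : v ∈ Y)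
    (h3 : dg G C v = 3) : #C = 3 ∧ ∀ c ∈ C, dg G Y c ≤ dg G Y v + 1 := by
  have hC3 : #C = 3 := (h.card_eq hC).resolve_right fun h4 => by
    have := h.dg_le_two hC hv h4; omega
  refine ⟨hC3, fun c hc => ?_⟩
  have h1 := dg_erase (G := G) hc v
  have h2 := ad_le_one (G := G) v c
  have h3 := ad_le_one (G := G) c v
  have := h.dg_swap_le hC hc hv (by omega)
  omega

lemma exists_common (h : OptFamily G S F Y) (hC : C ∈ F) {B : Finset V} (hB : B ⊆ Y) {q : ℕ}
    (hv : v ∈ Y) (hv2 : dg G C v = 2) (hq : dg G Y v ≤ q) (hB2 : ∀ y ∈ B, dg G C y ≤ 2) :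
    ∃ a ∈ C, ∃ b ∈ C, a ≠ b ∧ #B ≤ #(B.filter fun y => G.Adj a y ∧ G.Adj b y) +
      #(B.filter fun y => dg G C y ≤ 1) + q := by
  have hNv : #(C.filter (G.Adj v)) = 2 := by rw [← dg_eq_card, hv2]
  obtain ⟨a, b, hab, hN⟩ := card_eq_two.1 hNv
  have hmem : ∀ x, x ∈ C ∧ G.Adj v x ↔ x = a ∨ x = b := fun x => by
    rw [← mem_filter, hN]; simp
  obtain ⟨haC, hva⟩ := (hmem a).2 (Or.inl rfl)
  obtain ⟨hbC, hvb⟩ := (hmem b).2 (Or.inr rfl)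
  obtain ⟨c, hc, hvc⟩ : ∃ c ∈ C, ¬ G.Adj v c := by
    by_contra! hcon
    have := (dg_eq_card_iff (G := G) (S := C) (v := v)).2 hcon
    have := three_le_card (h.mem C hC).2
    omega
  refine ⟨a, haC, b, hbC, hab, ?_⟩
  have hcY : dg G Y c ≤ q := by
    have h1 := dg_erase (G := G) hc v
    rw [ad_of_not_adj hvc] at h1
    have h2 := h.dg_swap_le hC hc hv (by omega)
    rw [ad_of_not_adj fun h => hvc h.symm] at h2
    omega
  have hcB : #(B.filter (G.Adj c)) ≤ q := by
    rw [← dg_eq_card]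
    exact (dg_mono hB c).trans hcY
  have key : ∀ y ∈ B, ¬ G.Adj c y → 2 ≤ dg G C y → G.Adj a y ∧ G.Adj b y := by
    intro y hy hcy h2
    have h1 := dg_erase (G := G) hc y
    rw [ad_of_not_adj fun h => hcy h.symm] at h1
    have hac : a ∈ C.erase c := mem_erase.2 ⟨fun e => hvc (e ▸ hva), haC⟩
    have hbc : b ∈ C.erase c := mem_erase.2 ⟨fun e => hvc (e ▸ hvb), hbC⟩
    rcases h.card_eq hC with h3 | h4
    · have h5 : dg G (C.erase c) y = #(C.erase c) := by
        have := hB2 y hy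
        rw [card_erase_of_mem hc]
        omega
      rw [dg_eq_card_iff] at h5
      exact ⟨(h5 a hac).symm, (h5 b hbc).symm⟩
    · have hYy := mem_union_right C (hB hy)
      have main : ∀ a b, a ∈ C.erase c → b ∈ C.erase c → a ≠ b → G.Adj v a → G.Adj v b →
          G.Adj a y := by
        intro a b ha hb hab hva hvb
        by_contra hay
        have e1 := dg_erase (G := G) ha y
        rw [ad_of_not_adj fun h => hay h.symm] at e1
        have e2 : dg G ((C.erase c).erase a) y = #((C.erase c).erase a) := by
          have := hB2 y hy
          rw [card_erase_of_mem ha, card_erase_of_mem hc]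
          omega
        rw [dg_eq_card_iff] at e2
        have hb' : b ∈ (C.erase c).erase a := mem_erase.2 ⟨hab.symm, hb⟩
        obtain ⟨d, hd⟩ := card_pos.1 (by
          rw [card_erase_of_mem hb', card_erase_of_mem ha, card_erase_of_mem hc]; omega :
          0 < #(((C.erase c).erase a).erase b))
        have hCb := h.dg_self hC (mem_of_mem_erase hb)
        have e3 := dg_erase (G := G) hc b
        have e4 := dg_erase (G := G) ha b
        have e5 : ¬ G.Adj b a := fun hba =>
          h.not_triangle hC h4 (mem_union_right _ hv) (mem_union_left _ (mem_of_mem_erase ha))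
            (mem_union_left _ (mem_of_mem_erase hb)) hva hba.symm hvb
        rw [ad_of_not_adj e5] at e4
        have e6 := dg_erase (G := G) hb' b
        rw [ad_self] at e6
        have e7 := ad_le_one (G := G) b c
        have e8 := dg_le_card (G := G) (((C.erase c).erase a).erase b) b
        have e9 : #(((C.erase c).erase a).erase b) = 1 := by
          rw [card_erase_of_mem hb', card_erase_of_mem ha, card_erase_of_mem hc]; omega
        have e10 : dg G (((C.erase c).erase a).erase b) b =
            #(((C.erase c).erase a).erase b) := by omega
        rw [dg_eq_card_iff] at e10
        have hbd := e10 d hd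
        have hd' := mem_of_mem_erase hd
        exact h.not_triangle hC h4 hYy (mem_union_left _ (mem_of_mem_erase hb))
          (mem_union_left _ (mem_of_mem_erase (mem_of_mem_erase hd'))) (e2 b hb') hbd (e2 d hd')
      exact ⟨main a b hac hbc hab hva hvb, main b a hbc hac hab.symm hvb hva⟩
  have hsub : B ⊆ ((B.filter fun y => G.Adj a y ∧ G.Adj b y) ∪
      (B.filter fun y => dg G C y ≤ 1)) ∪ B.filter (G.Adj c) := by
    intro y hy
    have := key y hy
    simp only [mem_union, mem_filter, hy, true_and]
    by_cases h1 : G.Adj c y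
    · exact Or.inr h1
    by_cases h2 : dg G C y ≤ 1
    · exact Or.inl (Or.inr h2)
    · exact Or.inl (Or.inl (this h1 (by omega)))
  have h1 := card_le_card hsub
  have h2 := card_union_le ((B.filter fun y => G.Adj a y ∧ G.Adj b y) ∪
      (B.filter fun y => dg G C y ≤ 1)) (B.filter (G.Adj c))
  have h3 := card_union_le (B.filter fun y => G.Adj a y ∧ G.Adj b y)
      (B.filter fun y => dg G C y ≤ 1)
  omega

end OptFamily

/-- The weight of a vertex of degree `d`. -/
def wt (k d : ℕ) : ℤ := if 2 * k ≤ d then 2 else if 2 * k ≤ d + 1 then 1 else -1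

lemma wt_le_two (k d : ℕ) : wt k d ≤ 2 := by unfold wt; split_ifs <;> omega

lemma hl_le_wt {k : ℕ} (hk : 1 ≤ k) (d : ℕ) : 1 + 3 * hl k d ≤ 2 * wt k d := by
  unfold wt hl; split_ifs <;> omega

/-- The vertices of `Y` of small degree in `Y` that send many edges to the cycles of `F`. -/
def boundary (G : SimpleGraph V) (F : Finset (Finset V)) (Y : Finset V) (s : ℕ) : Finset V :=
  Y.filter fun y => dg G Y y ≤ s + 2 ∧ 2 * #F + s ≤ ∑ C ∈ F, dg G C y + 2

lemma boundary_subset {F : Finset (Finset V)} {Y : Finset V} {s : ℕ} :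
    boundary G F Y s ⊆ Y := filter_subset _ _

/-- The deficit of a boundary vertex. -/
def deficit (G : SimpleGraph V) (F : Finset (Finset V)) (s : ℕ) (y : V) : ℤ :=
  ∑ C ∈ F, (dg G C y : ℤ) - 2 * #F - s + 3

lemma sum_deficit (F : Finset (Finset V)) (s : ℕ) (B : Finset V) :
    ∑ y ∈ B, deficit G F s y =
      ∑ C ∈ F, (∑ y ∈ B, (dg G C y : ℤ) - 2 * #B) + (3 - s) * #B := by
  simp only [deficit, sum_add_distrib, sum_sub_distrib, sum_const, nsmul_eq_mul]
  rw [sum_comm]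
  ring

lemma deficit_pos {F : Finset (Finset V)} {Y : Finset V} {s : ℕ} {y : V}
    (hy : y ∈ boundary G F Y s) : 1 ≤ deficit G F s y := by
  have h := (mem_filter.1 hy).2.2
  zify at h
  unfold deficit
  omega

namespace OptFamily

variable {S Y C : Finset V} {F : Finset (Finset V)} {s : ℕ}

lemma sum_wt_rest (h : OptFamily G S F Y) (hs : 1 ≤ #F + s) (hS : Surplus G S (#F + s)) :
    25 * (s : ℤ) + 9 * #F ≤ 2 * ∑ y ∈ Y, wt (#F + s) (dg G S y) := by
  have h1 : ∑ y ∈ S, (1 + 3 * hl (#F + s) (dg G S y)) ≤ ∑ y ∈ S, 2 * wt (#F + s) (dg G S y) :=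
    sum_le_sum fun y _ => hl_le_wt hs _
  rw [sum_add_distrib, ← mul_sum, ← mul_sum] at h1
  simp only [sum_const, nsmul_eq_mul, mul_one] at h1
  have h2 := hS.2
  push_cast at h2
  have h5 := sum_sdiff (f := fun y => wt (#F + s) (dg G S y)) h.biUnion_id_subset
  rw [h.sdiff_eq] at h5
  have h3 : ∑ y ∈ F.biUnion id, wt (#F + s) (dg G S y) ≤ ∑ y ∈ F.biUnion id, 2 :=
    sum_le_sum fun y _ => wt_le_two _ _
  rw [sum_const, nsmul_eq_mul] at h3
  have h4 := card_biUnion_le_card_mul F id 4 h.card_le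
  zify at h4
  linarith

lemma sum_deficit_ge (h : OptFamily G S F Y) (hs : 1 ≤ s)
    (hW : 25 * (s : ℤ) + 9 * #F ≤ 2 * ∑ y ∈ Y, wt (#F + s) (dg G S y)) (hP : ¬ Pack G Y s) :
    11 * (s : ℤ) + 9 * #F + 14 ≤ 2 * ∑ y ∈ boundary G F Y s, min 3 (deficit G F s y) := by
  set φ : V → ℤ := fun y => if 2 * (#F + s) ≤ dg G S y + 1 then
    max (-1) (min (wt (#F + s) (dg G S y)) (dg G Y y - (s + 1))) else -1 with hφ
  have h1 : ∑ y ∈ Y, φ y < 7 * (s : ℤ) - 6 := by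
    by_contra! hc
    refine hP (pack_of_potential _ G Y φ s le_rfl h.rest (fun v _ => ?_) (fun v _ => ?_) hs hc)
    · have := wt_le_two (#F + s) (dg G S v)
      simp only [hφ]
      split_ifs <;> omega
    · simp only [hφ]
      split_ifs <;> omega
  have h2 : ∑ y ∈ Y, wt (#F + s) (dg G S y) ≤
      ∑ y ∈ Y, (φ y + if y ∈ boundary G F Y s then min 3 (deficit G F s y) else 0) := by
    refine sum_le_sum fun y hy => ?_
    have e1 := h.dg_eq_add y
    have e2 : y ∈ boundary G F Y s ↔
        (dg G Y y ≤ s + 2 ∧ 2 * #F + s ≤ ∑ C ∈ F, dg G C y + 2) := by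
      simp [boundary, hy]
    simp only [e2, hφ, deficit, wt]
    rw [← Nat.cast_sum]
    split_ifs <;> omega
  rw [sum_add_distrib, ← sum_filter, filter_mem_eq_inter,
    inter_eq_right.2 boundary_subset] at h2
  linarith

lemma sum_dg_le_of_dg_eq_three (h : OptFamily G S F Y) (hC : C ∈ F) {v : V}
    (hv : v ∈ boundary G F Y s) (h3 : dg G C v = 3) :
    ∑ y ∈ boundary G F Y s, dg G C y ≤ 3 * (s + 3) := by
  have hv' := mem_filter.1 hv
  obtain ⟨hC3, hc⟩ := h.dg_le_of_dg_eq_three hC hv'.1 h3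
  rw [sum_dg_comm, ← hC3, ← smul_eq_mul]
  refine sum_le_card_nsmul _ _ _ fun c hcC => ?_
  have h1 := dg_mono (G := G) (boundary_subset (G := G) (s := s) (F := F) (Y := Y)) c
  have := hc c hcC
  omega

lemma sum_dg_le (h : OptFamily G S F Y) (hC : C ∈ F)
    (h2 : ¬ ∃ v ∈ boundary G F Y s, dg G C v = 3) :
    ∀ v ∈ boundary G F Y s, dg G C v ≤ 2 := by
  intro v hv
  have := h.dg_le_three hC (mem_filter.1 hv).1
  by_contra! hc
  exact h2 ⟨v, hv, by omega⟩

end OptFamily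

namespace OptFamily

variable {S Y C : Finset V} {F : Finset (Finset V)} {s : ℕ}

lemma pack_of_two_le (h : OptFamily G S F Y) {k : ℕ} (hk : 2 ≤ k) (hFk : #F + s = k + 1)
    (hs : 2 ≤ s) (hS : Surplus G S (k + 1)) (ih : ∀ T, Surplus G T k → Pack G T k)
    (hm : 11 * (s : ℤ) + 9 * #F + 14 ≤ 2 * ∑ y ∈ boundary G F Y s, min 3 (deficit G F s y)) :
    Pack G S (k + 1) := by
  set B := boundary G F Y s with hB
  have h6 : ∑ y ∈ B, min 3 (deficit G F s y) ≤ ∑ y ∈ B, 3 :=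
    sum_le_sum fun y _ => min_le_left _ _
  rw [sum_const, nsmul_eq_mul] at h6
  have hspec : ∀ C ∈ F, (∃ v ∈ B, dg G C v = 3) → ∑ y ∈ B, (dg G C y : ℤ) - 2 * #B < 0 := by
    rintro C hC ⟨v, hv, h3⟩
    have h1 := h.sum_dg_le_of_dg_eq_three hC hv h3
    have h2 := card_pos.2 ⟨C, hC⟩
    zify at h1
    rw [← hB] at h1
    omega
  have hle : ∀ C ∈ F, ∑ y ∈ B, (dg G C y : ℤ) - 2 * #B ≤ 0 := by
    intro C hC
    by_cases h2 : ∃ v ∈ B, dg G C v = 3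
    · exact (hspec C hC h2).le
    · have h3 := sum_le_card_nsmul B (fun y => (dg G C y : ℤ)) 2 fun y hy => by
        exact_mod_cast h.sum_dg_le hC h2 y hy
      rw [nsmul_eq_mul] at h3
      linarith
  have h7 : ∑ y ∈ B, (1 : ℤ) ≤ ∑ y ∈ B, deficit G F s y := sum_le_sum fun y hy => deficit_pos hy
  rw [sum_deficit, sum_const, nsmul_eq_mul, mul_one] at h7
  have h8 := sum_nonpos hle
  have hs2 : s = 2 := by
    by_contra hne
    have : 1 ≤ (s : ℤ) - 2 := by omega
    nlinarith
  subst hs2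
  have hns : ∀ C ∈ F, ¬ ∃ v ∈ B, dg G C v = 3 := by
    intro C hC h2
    have := sum_lt_sum hle ⟨C, hC, hspec C hC h2⟩
    rw [sum_const_zero] at this
    push_cast at h7
    linarith
  have h9 : ∀ y ∈ B, ∀ C ∈ F, dg G C y = 2 := by
    intro y hy C hC
    refine le_antisymm (h.sum_dg_le hC (hns C hC) y hy) ?_
    by_contra! hlt
    have h1 : ∑ C ∈ F, dg G C y < ∑ C ∈ F, 2 :=
      sum_lt_sum (fun C hC => h.sum_dg_le hC (hns C hC) y hy) ⟨C, hC, hlt⟩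
    have h2 := (mem_filter.1 hy).2.2
    rw [sum_const, smul_eq_mul] at h1
    omega
  have h10 : ∑ y ∈ B, min 3 (deficit G F 2 y) ≤ ∑ y ∈ B, 1 := by
    refine sum_le_sum fun y hy => ?_
    have h1 : ∑ C ∈ F, (dg G C y : ℤ) = ∑ C ∈ F, 2 := sum_congr rfl fun C hC => by
      rw [h9 y hy C hC]; rfl
    rw [sum_const, nsmul_eq_mul] at h1
    unfold deficit
    push_cast
    omega
  rw [sum_const, nsmul_eq_mul] at h10
  obtain ⟨v, hv⟩ := card_pos.1 (by omega : 0 < #B)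
  obtain ⟨C, hC⟩ := card_pos.1 (by omega : 0 < #F)
  obtain ⟨a, ha, b, hb, hab, hcard⟩ := h.exists_common hC boundary_subset
    (boundary_subset hv) (h9 v hv C hC) (mem_filter.1 hv).2.1
    fun y hy => (h9 y hy C hC).le
  rw [← hB] at hcard
  have h11 : B.filter (fun y => dg G C y ≤ 1) = ∅ := by
    refine filter_eq_empty_iff.2 fun y hy => ?_
    rw [h9 y hy C hC]
    norm_num
  rw [h11, card_empty] at hcard
  refine pack_of_hub (by omega) ((h.mem C hC).1 ha) ((h.mem C hC).1 hb) hab hS ih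
    (N := B.filter fun y => G.Adj a y ∧ G.Adj b y)
    ((filter_subset _ _).trans (boundary_subset.trans h.rest_subset))
    (fun x hx => (mem_filter.1 hx).2) ?_
  omega

lemma sum_dg_sub_two_le (h : OptFamily G S F Y) (hC : C ∈ F) (hP : ¬ Pack G S (#F + 1))
    {Z N : Finset V} {a b : V} (hZ : Z ⊆ Y) (hZ0 : Z.Nonempty) (ha : a ∈ C) (hb : b ∈ C)
    (hab : a ≠ b) (hNZ : N ⊆ Z) (hN : ∀ x ∈ N, G.Adj a x ∧ G.Adj b x) :
    ∃ z ∈ Z, ∑ x ∈ Z.erase z, ((dg G Z x : ℤ) - 2) ≤ 1 - #N := by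
  have hY : ∀ K ⊆ Y, ¬ Dense G K := fun K hK hd => hP (Pack.of_family h.mem h.disj
    (by rw [h.sdiff_eq]; exact Pack.cons hK hd trivial))
  obtain ⟨z, hz, hc⟩ := exists_center (G := G) _ Z (fun x => if x ∈ N then 1 else 0)
    (fun x => if x ∈ N then 1 else 0) rfl hZ0 (fun K hK => hY K (hK.trans hZ)) (by
    intro K hK K' hK' hKK hd hd'
    have haN : ∀ L ⊆ Z, a ∉ L := fun L hL haL => h.notMem hC (hZ (hL haL)) ha
    have hbN : ∀ L ⊆ Z, b ∉ L := fun L hL hbL => h.notMem hC (hZ (hL hbL)) hb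
    have hcard : #F + 1 = #(F.erase C) + 2 := by
      rw [card_erase_of_mem hC]
      have := card_pos.2 ⟨C, hC⟩
      omega
    refine hP ?_
    rw [hcard]
    have hsub : ∀ v ∈ C, ∀ L ⊆ Z, insert v L ⊆ S \ (F.erase C).biUnion id := by
      intro v hv L hL
      rw [h.sdiff_erase hC, h.sdiff_eq]
      exact insert_subset (mem_union_left _ hv) ((hL.trans hZ).trans subset_union_right)
    refine Pack.of_family (h.erase C).mem (h.erase C).disj
      (Pack.two (hsub a ha K hK) (hsub b hb K' hK') ?_ ?_ ?_)
    · refine CDense.dense_insert (haN K hK) (hd.mono fun x _ => ?_)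
      split_ifs with hx
      · rw [ad_of_adj (hN x hx).1]
      · exact Nat.zero_le _
    · refine CDense.dense_insert (hbN K' hK') (hd'.mono fun x _ => ?_)
      split_ifs with hx
      · rw [ad_of_adj (hN x hx).2]
      · exact Nat.zero_le _
    · simp [disjoint_insert_left, disjoint_insert_right, haN K' hK', hbN K hK, hab.symm, hKK])
  rw [or_self] at hc
  refine ⟨z, hz, ?_⟩
  have e1 := hc _ Subset.rfl
  unfold CDense at e1
  rw [sum_indicator] at e1
  have e2 := sum_dg_erase (G := G) hz
  have e3 := ed_lt_of_not_dense (hY Z hZ) hZ0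
  have e4 : #(Z.erase z) + 1 = #Z := card_erase_add_one hz
  have e5 : #N ≤ #(Z.erase z ∩ N) + 1 := by
    have h6 : N ⊆ insert z (Z.erase z ∩ N) := by
      intro x hx
      have := hNZ hx
      simp only [mem_insert, mem_inter, mem_erase]
      tauto
    have := card_le_card h6
    have := card_insert_le z (Z.erase z ∩ N)
    omega
  rw [sum_sub_distrib, sum_const, nsmul_eq_mul, ← Nat.cast_sum]
  omega

lemma pack_of_one (h : OptFamily G S F Y) (hF : 2 ≤ #F) (hS : Surplus G S (#F + 1))
    (ih : ∀ T, Surplus G T #F → Pack G T #F)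
    (hW : 25 + 9 * #F ≤ 2 * ∑ y ∈ Y, wt (#F + 1) (dg G S y))
    (hm : 25 + 9 * (#F : ℤ) ≤ 2 * ∑ y ∈ boundary G F Y 1, min 3 (deficit G F 1 y)) :
    Pack G S (#F + 1) := by
  by_contra hP
  set B := boundary G F Y 1 with hB
  have h6 : ∑ y ∈ B, min 3 (deficit G F 1 y) ≤ ∑ y ∈ B, 3 :=
    sum_le_sum fun y _ => min_le_left _ _
  have h6' : ∑ y ∈ B, min 3 (deficit G F 1 y) ≤ ∑ y ∈ B, deficit G F 1 y :=
    sum_le_sum fun y _ => min_le_right _ _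
  have hX := sum_deficit (G := G) F 1 B
  rw [sum_const, nsmul_eq_mul] at h6
  push_cast at hX
  have hns : ∀ C ∈ F, ¬ ∃ v ∈ B, dg G C v = 3 := by
    have hspec : ∀ C ∈ F, (∃ v ∈ B, dg G C v = 3) →
        ∑ y ∈ B, (dg G C y : ℤ) - 2 * #B ≤ 12 - 2 * #B := by
      rintro C hC ⟨v, hv, h3⟩
      have h1 := h.sum_dg_le_of_dg_eq_three hC hv h3
      zify at h1
      rw [← hB] at h1
      omega
    have hle : ∀ C ∈ F, ∑ y ∈ B, (dg G C y : ℤ) - 2 * #B ≤ 0 := by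
      intro C hC
      by_cases h2 : ∃ v ∈ B, dg G C v = 3
      · have := hspec C hC h2
        omega
      · have h3 := sum_le_card_nsmul B (fun y => (dg G C y : ℤ)) 2 fun y hy => by
          exact_mod_cast h.sum_dg_le hC h2 y hy
        rw [nsmul_eq_mul] at h3
        linarith
    intro C hC h2
    rw [← add_sum_erase _ _ hC] at hX
    have h8 := sum_nonpos fun D (hD : D ∈ F.erase C) => hle D (mem_of_mem_erase hD)
    have h9 := hspec C hC h2
    linarith
  have h2 : ∀ y ∈ B, ∀ C ∈ F, dg G C y ≤ 2 := fun y hy C hC => h.sum_dg_le hC (hns C hC) y hy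
  have hx2 : ∀ y ∈ B, deficit G F 1 y ≤ 2 := by
    intro y hy
    have h3 := sum_le_card_nsmul F (fun C => (dg G C y : ℤ)) 2 fun C hC => by
      exact_mod_cast h2 y hy C hC
    rw [nsmul_eq_mul] at h3
    unfold deficit
    push_cast
    linarith
  have hXm : (#B : ℤ) ≤ ∑ y ∈ B, deficit G F 1 y := by
    have h7 : ∑ y ∈ B, (1 : ℤ) ≤ ∑ y ∈ B, deficit G F 1 y :=
      sum_le_sum fun y hy => deficit_pos hy
    simpa using h7
  obtain ⟨C, hC, hdef⟩ : ∃ C ∈ F, (#F : ℤ) * #(B.filter fun y => dg G C y ≤ 1) ≤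
      2 * #B - ∑ y ∈ B, deficit G F 1 y := by
    have h8 : ∀ C ∈ F, ∑ y ∈ B, (dg G C y : ℤ) - 2 * #B ≤
        -#(B.filter fun y => dg G C y ≤ 1) := by
      intro C hC
      have : ∑ y ∈ B, (dg G C y : ℤ) ≤ ∑ y ∈ B, (2 - if dg G C y ≤ 1 then 1 else 0) :=
        sum_le_sum fun y hy => by
          have := h2 y hy C hC
          split_ifs <;> omega
      rw [sum_sub_distrib, sum_const, nsmul_eq_mul, ← sum_filter, sum_const, nsmul_eq_mul] at this
      linarith
    by_contra! hcon
    have h9 := sum_le_sum h8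
    rw [sum_neg_distrib] at h9
    have h10 := sum_lt_sum_of_nonempty (card_pos.1 (by omega : 0 < #F)) hcon
    rw [sum_const, nsmul_eq_mul, ← mul_sum] at h10
    have h11 : (0 : ℤ) < #F := by omega
    have h12 := lt_of_mul_lt_mul_left h10 h11.le
    linarith
  set d := #(B.filter fun y => dg G C y ≤ 1) with hd
  have hd2 : 2 * (d : ℤ) ≤ 2 * #B - ∑ y ∈ B, deficit G F 1 y := by
    have : (2 : ℤ) * d ≤ #F * d := by gcongr; exact_mod_cast hF
    linarith
  obtain ⟨v, hv, hv2⟩ : ∃ v ∈ B, ¬ dg G C v ≤ 1 := by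
    by_contra! hcon
    rw [filter_true_of_mem hcon] at hd
    omega
  obtain ⟨a, ha, b, hb, hab, hcard⟩ := h.exists_common hC boundary_subset
    (boundary_subset hv) (le_antisymm (h2 v hv C hC) (by omega)) (mem_filter.1 hv).2.1
    fun y hy => h2 y hy C hC
  rw [← hB, ← hd] at hcard
  set N := B.filter fun y => G.Adj a y ∧ G.Adj b y with hN
  have hNadj : ∀ x ∈ N, G.Adj a x ∧ G.Adj b x := fun x hx => (mem_filter.1 hx).2
  have hNB : N ⊆ B := filter_subset _ _
  set Z := Y.filter fun y => 0 < dg G Y y ∨ y ∈ B with hZ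
  have hZY : Z ⊆ Y := filter_subset _ _
  have hBZ : B ⊆ Z := fun y hy => mem_filter.2 ⟨boundary_subset hy, Or.inr hy⟩
  obtain ⟨z, hz, hsum⟩ := h.sum_dg_sub_two_le hC hP hZY ⟨v, hBZ hv⟩ ha hb hab
    (hNB.trans hBZ) hNadj
  have hdgZ : ∀ y ∈ Y, dg G Z y = dg G Y y := by
    intro y hy
    have h1 := dg_sdiff (G := G) hZY y
    have h3 : dg G (Y \ Z) y = 0 := by
      rw [dg]
      refine sum_eq_zero fun u hu => ad_of_not_adj fun hyu => ?_
      have h4 := ad_le_dg (G := G) hy u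
      rw [ad_of_adj hyu.symm] at h4
      rw [mem_sdiff, hZ, mem_filter, not_and, not_or] at hu
      exact (hu.2 hu.1).1 h4
    omega
  have hBd : ∀ y ∈ Y, y ∈ B ↔ (dg G Y y ≤ 1 + 2 ∧ 2 * #F + 1 ≤ ∑ C ∈ F, dg G C y + 2) :=
    fun y hy => by simp [hB, boundary, hy]
  have hwtZ : ∀ y ∈ Z, wt (#F + 1) (dg G S y) ≤
      (dg G Z y : ℤ) - 2 + if y ∈ B then deficit G F 1 y else 0 := by
    intro y hy
    have e1 := h.dg_eq_add y
    have hyY := hZY hy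
    have e2 := (mem_filter.1 hy).2
    rw [hdgZ y hyY]
    simp only [hBd y hyY] at e2 ⊢
    unfold wt deficit
    rw [← Nat.cast_sum]
    split_ifs <;> omega
  have hwtY : ∀ y ∈ Y \ Z, wt (#F + 1) (dg G S y) ≤ 0 := by
    intro y hy
    have e1 := h.dg_eq_add y
    rw [mem_sdiff, hZ, mem_filter, not_and, not_or] at hy
    have e2 := hy.2 hy.1
    rw [hBd y hy.1] at e2
    unfold wt
    split_ifs <;> omega
  have e1 := sum_sdiff (f := fun y => wt (#F + 1) (dg G S y)) hZY
  have e2 := sum_nonpos hwtY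
  have e3 := add_sum_erase Z (fun y => wt (#F + 1) (dg G S y)) hz
  have e4 := sum_le_sum fun y (hy : y ∈ Z.erase z) => hwtZ y (mem_of_mem_erase hy)
  rw [sum_add_distrib] at e4
  have e5 : ∑ y ∈ Z.erase z, (if y ∈ B then deficit G F 1 y else 0) ≤
      ∑ y ∈ B, deficit G F 1 y := by
    rw [← sum_filter]
    refine sum_le_sum_of_subset_of_nonneg (fun y hy => (mem_filter.1 hy).2) fun y hy _ => ?_
    have := deficit_pos hy
    omega
  have e6 := wt_le_two (#F + 1) (dg G S z)
  refine hP (pack_of_hub (by omega) ((h.mem C hC).1 ha) ((h.mem C hC).1 hb) hab hS ih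
    (N := N) ((hNB.trans boundary_subset).trans h.rest_subset) hNadj ?_)
  omega

end OptFamily

lemma pack_of_surplus_succ {k : ℕ} (hk : 2 ≤ k) (ih : ∀ T, Surplus G T k → Pack G T k)
    {S : Finset V} (hS : Surplus G S (k + 1)) : Pack G S (k + 1) := by
  obtain ⟨F, Y, h⟩ := exists_optFamily G S
  by_contra hP
  have hFk : #F ≤ k := by
    by_contra! hc
    obtain ⟨F', hF', hcard⟩ := exists_subset_card_eq (Nat.succ_le_of_lt hc)
    have := Pack.of_family (j := 0) (fun C hC => h.mem C (hF' hC))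
      (h.disj.subset (by exact_mod_cast hF')) trivial
    rw [hcard] at this
    exact hP this
  obtain ⟨s, hs⟩ : ∃ s, #F + s = k + 1 := ⟨k + 1 - #F, by omega⟩
  have hPY : ¬ Pack G Y s := fun hp => hP (by
    rw [← hs]
    exact Pack.of_family h.mem h.disj (by rwa [h.sdiff_eq]))
  have hW := h.sum_wt_rest (s := s) (by omega) (by rwa [hs])
  have hm := h.sum_deficit_ge (by omega) hW hPY
  by_cases hs2 : 2 ≤ s
  · exact hP (h.pack_of_two_le hk hs hs2 hS ih hm)
  obtain rfl : s = 1 := by omega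
  obtain rfl : #F = k := by omega
  push_cast at hW hm
  exact hP (h.pack_of_one hk hS ih (by linarith) (by linarith))

theorem pack_of_surplus {k : ℕ} (hk : 2 ≤ k) : ∀ S, Surplus G S k → Pack G S k := by
  induction k, hk using Nat.le_induction with
  | base =>
    rintro S ⟨h1, h2⟩
    push_cast at h1 h2
    refine pack_two _ G S le_rfl (h1.trans (sum_le_sum fun x _ => ?_)) ?_
    · unfold hl tau
      split_ifs <;> omega
    · have h3 : ∑ x ∈ S, (1 + 3 * hl 2 (dg G S x)) ≤ ∑ x ∈ S, alp (dg G S x) :=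
        sum_le_sum fun x _ => by
          unfold hl alp
          split_ifs <;> omega
      rw [sum_add_distrib, ← mul_sum, sum_const, nsmul_eq_mul] at h3
      linarith
  | succ k hk ih => exact fun S hS => pack_of_surplus_succ hk ih hS

lemma Dense.exists_isCycle {K : Finset V} (h : Dense G K) :
    ∃ (v : V) (c : G.Walk v v), c.IsCycle ∧ ∀ x ∈ c.support, x ∈ K := by
  obtain ⟨E, hEK, hE, hm⟩ := exists_min_dense Subset.rfl h
  have h2 := (dg_eq_two_of_min hE fun x hx =>
    not_dense_erase (fun L hL => hm L (hL.trans hEK)) hx).2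
  suffices hac : ¬ (G.induce (E : Set V)).IsAcyclic by
    unfold SimpleGraph.IsAcyclic at hac
    push Not at hac
    obtain ⟨v, c, hc⟩ := hac
    have hinj : Function.Injective (SimpleGraph.Embedding.induce (G := G) (E : Set V)).toHom :=
      Subtype.val_injective
    refine ⟨_, c.map _, hc.map hinj, fun x hx => ?_⟩
    rw [SimpleGraph.Walk.support_map, List.mem_map] at hx
    obtain ⟨y, -, rfl⟩ := hx
    exact hEK y.2
  intro hac
  have : Nonempty (E : Set V) := hE.1.to_subtype
  obtain ⟨u, v, p, hp, hmax⟩ :=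
    SimpleGraph.Walk.exists_isPath_forall_isPath_length_le_length (G.induce (E : Set V))
  have hsub : E.filter (G.Adj u) ⊆ {(p.snd : V)} := by
    intro x hx
    rw [mem_filter] at hx
    have hadj : (G.induce (E : Set V)).Adj u ⟨x, hx.1⟩ := hx.2
    have hsupp : (⟨x, hx.1⟩ : (E : Set V)) ∈ p.support := by
      by_contra hns
      have := hmax _ _ _ (hp.cons hns (h := hadj.symm))
      simp at this
    have := hac.eq_snd_of_adj_start hp hadj hsupp
    rw [← this]
    simp
  have h3 := card_le_card hsub
  rw [← dg_eq_card, h2 u u.2, card_singleton] at h3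
  omega

lemma hasDisjointCycles_of_pack {S : Finset V} {k : ℕ} (h : Pack G S k) :
    HasDisjointCycles G k := by
  obtain ⟨F, rfl, hF, hdisj⟩ := h.exists_family
  have hc : ∀ C : F, ∃ c : (v : V) × G.Walk v v, c.2.IsCycle ∧ ∀ x ∈ c.2.support, x ∈ C.1 :=
    fun C => by
      obtain ⟨v, c, hc⟩ := (hF C C.2).2.1.exists_isCycle
      exact ⟨⟨v, c⟩, hc⟩
  choose c hc hcC using hc
  refine ⟨fun i => c (F.equivFin.symm i), fun i => hc _, fun i j hij x hx hy => ?_⟩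
  refine disjoint_left.1 (hdisj (F.equivFin.symm i).2 (F.equivFin.symm j).2 fun e => hij ?_)
    (hcC _ x hx) (hcC _ x hy)
  exact F.equivFin.symm.injective (Subtype.ext e)

lemma sum_hl [Fintype V] [DecidableRel G.Adj] {k : ℕ} (hk : 1 ≤ k) :
    ∑ x, hl k (dg G univ x) = #(highSet G k) - #(lowSet G k) := by
  have h1 : ∀ x, dg G univ x = G.degree x := fun x => by
    rw [dg_eq_card, ← SimpleGraph.card_neighborFinset_eq_degree]
    congr 1
    ext y
    simp
  have h2 : ∀ x, hl k (dg G univ x) =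
      (if 2 * k ≤ G.degree x then 1 else 0) - (if G.degree x ≤ 2 * k - 2 then 1 else 0) := by
    intro x
    rw [h1, hl]
    split_ifs <;> omega
  simp only [h2, sum_sub_distrib, highSet, lowSet, sum_boole]

end

end DisjointCycles

/-- The technical induction statement: if `2 ≤ k`, `i ≤ k`, `|G| ≥ 16k + 3i` and
`|H_k(G)| - |L_k(G)| ≥ 3k - i`, then `G` contains `k` disjoint cycles. -/
theorem kkm_induct {V : Type*} [Fintype V] (G : SimpleGraph V) [DecidableRel G.Adj]
    (k : ℕ) (i : ℤ) (hk : 2 ≤ k) (hi : i ≤ (k : ℤ))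
    (hcard : 16 * (k : ℤ) + 3 * i ≤ (Fintype.card V : ℤ))
    (h : ((lowSet G k).card : ℤ) + (3 * (k : ℤ) - i) ≤ ((highSet G k).card : ℤ)) :
    HasDisjointCycles G k := by
  refine DisjointCycles.hasDisjointCycles_of_pack
    (DisjointCycles.pack_of_surplus hk Finset.univ ?_)
  unfold DisjointCycles.Surplus
  rw [DisjointCycles.sum_hl (by omega), Finset.card_univ]
  constructor <;> linarith
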